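/- Fix λ > 10 and ε ∈ (0,1). Set A = N·e^{-ε√(log N)}, Q = (log N)^λ, τ = A²·N^{-1}·Q^{-1}, let 𝔐 be the union over 1 ≤ q ≤ Q and 0 ≤ a ≤ q−1 with gcd(a,q)=1 of the intervals {α ∈ [−1/τ, 1−1/τ] : |α − a/q| ≤ 1/τ}, and let m = [−1/τ, 1−1/τ] \ 𝔐. Then for all sufficiently large even N, ∫_m F(α,A)²·F̃(α,A)·e^{−2πiNα} dα ≪ A² / (log N)^{λ/2 − 5}. -/

import Mathlib

open Finset Real MeasureTheory
open scoped BigOperators Classical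

/-- `e(x) = exp(2πix)`. -/
noncomputable def e (x : ℝ) : ℂ := Complex.exp (2 * Real.pi * Complex.I * x)

/-- `A = N·e^{−ε√(log N)}`. -/
noncomputable def Aof (ε : ℝ) (N : ℕ) : ℝ := (N : ℝ) * Real.exp (-ε * Real.sqrt (Real.log N))

/-- `Q = (log N)^λ`. -/
noncomputable def Qof (lam : ℝ) (N : ℕ) : ℝ := Real.log N ^ (lam : ℝ)

/-- `τ = A²·N⁻¹·Q⁻¹`. -/
noncomputable def tauof (ε lam : ℝ) (N : ℕ) : ℝ := Aof ε N ^ 2 * (N : ℝ)⁻¹ * (Qof lam N)⁻¹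

/-- The major arcs: all `α ∈ [−1/τ, 1−1/τ]` with `|α − a/q| ≤ 1/τ` for some `1 ≤ q ≤ Q`,
`0 ≤ a ≤ q−1`, `gcd(a,q) = 1`. -/
noncomputable def Major (ε lam : ℝ) (N : ℕ) : Set ℝ :=
  {α : ℝ | α ∈ Set.Icc (-(1 / tauof ε lam N)) (1 - 1 / tauof ε lam N) ∧
    ∃ q a : ℕ, 1 ≤ q ∧ (q : ℝ) ≤ Qof lam N ∧ a < q ∧ Nat.gcd a q = 1 ∧
      |α - (a : ℝ) / q| ≤ 1 / tauof ε lam N}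

/-- The minor arcs `m = [−1/τ, 1−1/τ] \ 𝔐`. -/
noncomputable def Minor (ε lam : ℝ) (N : ℕ) : Set ℝ :=
  Set.Icc (-(1 / tauof ε lam N)) (1 - 1 / tauof ε lam N) \ Major ε lam N

/-- `F(α,A) = Σ_{N/2−A < p ≤ N/2+A} (log p)·e(αp)`, sum over primes `p`. -/
noncomputable def F (N : ℕ) (A α : ℝ) : ℂ :=
  ∑ p ∈ (Finset.range (2 * N + 2)).filter
      (fun p => Nat.Prime p ∧ (N : ℝ) / 2 - A < (p : ℝ) ∧ (p : ℝ) ≤ (N : ℝ) / 2 + A),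
    (Real.log p : ℂ) * e (α * p)

/-- `F̃(α,A) = Σ_{2 < p ≤ A} (log p)·e(α·2p)`, sum over primes `p`. -/
noncomputable def Ftilde (A α : ℝ) : ℂ :=
  ∑ p ∈ (Finset.range (⌊A⌋₊ + 1)).filter
      (fun p => Nat.Prime p ∧ 2 < p ∧ (p : ℝ) ≤ A),
    (Real.log p : ℂ) * e (α * (2 * p))

/-! ### The kernel bounding geometric sums -/

lemma e_add (x y : ℝ) : e (x + y) = e x * e y := by
  simp only [e, ← Complex.exp_add]; push_cast; ring_nf

lemma norm_e (x : ℝ) : ‖e x‖ = 1 := by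
  have : e x = Complex.exp ((2 * Real.pi * x : ℝ) * Complex.I) := by
    simp only [e]; push_cast; ring_nf
  rw [this, Complex.norm_exp_ofReal_mul_I]

lemma e_intCast (n : ℤ) : e n = 1 := by
  rw [e, show (2 * Real.pi * Complex.I * ((n : ℝ) : ℂ)) = n * (2 * Real.pi * Complex.I) by
    push_cast; ring]
  exact Complex.exp_int_mul_two_pi_mul_I n

lemma conj_e (x : ℝ) : (starRingEnd ℂ) (e x) = e (-x) := by
  simp only [e, ← Complex.exp_conj]
  simp [map_ofNat]

lemma continuous_e : Continuous e := by
  unfold e; fun_prop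

/-- The distance from `x` to the nearest integer. -/
noncomputable def distInt (x : ℝ) : ℝ := |x - round x|

/-- A quantity comparable to `min Y (1 / distInt x)`. -/
noncomputable def geomKernel (Y x : ℝ) : ℝ := 2 * Y / (1 + Y * distInt x)

lemma distInt_nonneg (x : ℝ) : 0 ≤ distInt x := abs_nonneg _

lemma distInt_neg (x : ℝ) : distInt (-x) = distInt x := by
  apply le_antisymm
  · have := round_le (-x) (-round x)
    simp only [distInt]
    refine this.trans (le_of_eq ?_)
    push_cast
    rw [← abs_neg]; ring_nf
  · have := round_le x (-round (-x))
    simp only [distInt]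
    refine this.trans (le_of_eq ?_)
    push_cast
    rw [← abs_neg]; ring_nf

lemma geomKernel_neg (Y x : ℝ) : geomKernel Y (-x) = geomKernel Y x := by
  simp [geomKernel, distInt_neg]

lemma geomKernel_nonneg {Y : ℝ} (hY : 0 ≤ Y) (x : ℝ) : 0 ≤ geomKernel Y x := by
  have := distInt_nonneg x
  unfold geomKernel; positivity

lemma geomKernel_le {Y : ℝ} (hY : 0 ≤ Y) (x : ℝ) : geomKernel Y x ≤ 2 * Y := by
  have := distInt_nonneg x
  exact div_le_self (by positivity) (by nlinarith [mul_nonneg hY this])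

lemma geomKernel_mono {Y Z : ℝ} (hY : 0 ≤ Y) (h : Y ≤ Z) (x : ℝ) :
    geomKernel Y x ≤ geomKernel Z x := by
  have hd := distInt_nonneg x
  have hZ := hY.trans h
  unfold geomKernel
  rw [div_le_div_iff₀ (by positivity) (by positivity)]
  nlinarith

lemma geomKernel_le_two_div {Y x d : ℝ} (hY : 0 ≤ Y) (hd : 0 < d) (h : d ≤ distInt x) :
    geomKernel Y x ≤ 2 / d := by
  have := distInt_nonneg x
  unfold geomKernel
  rw [div_le_div_iff₀ (by positivity) hd]
  nlinarith [mul_le_mul_of_nonneg_left h hY]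

lemma geomKernel_le_two_mul {Y Z x : ℝ} (hY : 0 ≤ Y) (hZ : 0 < Z) (h : 1 ≤ Z * distInt x) :
    geomKernel Y x ≤ 2 * geomKernel Z x := by
  have hd : 0 < distInt x := by
    rcases (distInt_nonneg x).lt_or_eq with h0 | h0
    · exact h0
    · rw [← h0] at h; norm_num at h
  refine (geomKernel_le_two_div hY hd le_rfl).trans ?_
  unfold geomKernel
  rw [← mul_div_assoc, div_le_div_iff₀ hd (by positivity)]
  nlinarith

lemma four_mul_distInt_le (x : ℝ) : 4 * distInt x ≤ ‖e x - 1‖ := by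
  have h1 : e x = e (x - round x) := by
    conv_lhs => rw [show x = (x - round x) + ((round x : ℤ) : ℝ) by ring, e_add, e_intCast, mul_one]
  have h2 : e (x - round x) = Complex.exp (Complex.I * ((2 * Real.pi * (x - round x) : ℝ) : ℂ)) := by
    simp only [e]; push_cast; ring_nf
  have h3 : |Real.pi * (x - round x)| ≤ Real.pi / 2 := by
    rw [abs_mul, abs_of_pos Real.pi_pos]
    have := abs_sub_round x
    nlinarith [Real.pi_pos]
  have h4 := Real.mul_abs_le_abs_sin h3
  rw [h1, h2, Complex.norm_exp_I_mul_ofReal_sub_one, Real.norm_eq_abs, abs_mul,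
    show 2 * Real.pi * (x - round x) / 2 = Real.pi * (x - round x) by ring, abs_two]
  rw [abs_mul, abs_of_pos Real.pi_pos, ← mul_assoc, div_mul_cancel₀ _ Real.pi_ne_zero] at h4
  simp only [distInt]
  linarith

lemma sum_e_mul_sub (x : ℝ) {a b : ℕ} (hab : a ≤ b) :
    (∑ m ∈ Ioc a b, e (m * x)) * (e x - 1) = e ((b + 1 : ℕ) * x) - e ((a + 1 : ℕ) * x) := by
  induction b, hab using Nat.le_induction with
  | base => simp
  | succ b hb ih =>
    rw [sum_Ioc_succ_top (by omega), add_mul, ih]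
    have : e ((b + 1 + 1 : ℕ) * x) = e ((b + 1 : ℕ) * x) * e x := by
      rw [← e_add]; push_cast; ring_nf
    rw [this]; ring

lemma norm_sum_e_le (x : ℝ) {a b : ℕ} {Y : ℝ} (hb : (b : ℝ) ≤ Y) :
    ‖∑ m ∈ Ioc a b, e (m * x)‖ ≤ geomKernel Y x := by
  have hY : 0 ≤ Y := (Nat.cast_nonneg b).trans hb
  rcases le_total a b with hab | hab
  swap
  · rw [Ioc_eq_empty_of_le hab]; simpa using geomKernel_nonneg hY x
  have h1 : ‖∑ m ∈ Ioc a b, e (m * x)‖ ≤ Y := by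
    refine (norm_sum_le _ _).trans ?_
    simp only [norm_e, sum_const, Nat.card_Ioc, nsmul_eq_mul, mul_one]
    refine le_trans ?_ hb
    exact_mod_cast Nat.sub_le b a
  have h2 : ‖∑ m ∈ Ioc a b, e (m * x)‖ * ‖e x - 1‖ ≤ 2 := by
    rw [← norm_mul, sum_e_mul_sub x hab]
    refine (norm_sub_le _ _).trans ?_
    rw [norm_e, norm_e]; norm_num
  have h3 := four_mul_distInt_le x
  have hd := distInt_nonneg x
  have h4 := norm_nonneg (∑ m ∈ Ioc a b, e (m * x))
  unfold geomKernel
  rw [le_div_iff₀ (by positivity)]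
  have h5 : ‖∑ m ∈ Ioc a b, e (m * x)‖ * distInt x ≤ 1 / 2 := by nlinarith
  nlinarith

/-- Abel summation with monotone nonnegative weights. -/
lemma norm_sum_monotone_mul_le {f : ℕ → ℝ} (hf : Monotone f) (h0 : 0 ≤ f 0) {w : ℕ → ℂ} {a b : ℕ}
    (hab : a ≤ b) {B : ℝ} (hB : ∀ c, ‖∑ m ∈ Ioc c b, w m‖ ≤ B) :
    ‖∑ m ∈ Ioc a b, (f m : ℂ) * w m‖ ≤ f b * B := by
  have key : ∀ c, c ≤ b → ‖∑ m ∈ Ioc c b, (f m : ℂ) * w m - f c * ∑ m ∈ Ioc c b, w m‖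
      ≤ (f b - f c) * B := by
    intro c hc
    induction hc using Nat.decreasingInduction with
    | self => simp
    | of_succ c hc ih =>
      have e1 : ∀ g : ℕ → ℂ, ∑ m ∈ Ioc c b, g m = g (c + 1) + ∑ m ∈ Ioc (c + 1) b, g m := by
        intro g
        rw [← Finset.insert_Ioc_add_one_left_eq_Ioc (by omega : c < b), sum_insert (by simp)]
      have e2 : ∑ m ∈ Ioc c b, (f m : ℂ) * w m - f c * ∑ m ∈ Ioc c b, w m =
          (∑ m ∈ Ioc (c + 1) b, (f m : ℂ) * w m - f (c + 1) * ∑ m ∈ Ioc (c + 1) b, w m) +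
          ((f (c + 1) - f c : ℝ) : ℂ) * ∑ m ∈ Ioc c b, w m := by
        rw [e1 w, e1 (fun m => (f m : ℂ) * w m)]; push_cast; ring
      rw [e2]
      refine (norm_add_le _ _).trans ?_
      have hm : 0 ≤ f (c + 1) - f c := sub_nonneg.2 (hf (Nat.le_succ c))
      rw [norm_mul, Complex.norm_real, Real.norm_of_nonneg hm]
      nlinarith [mul_le_mul_of_nonneg_left (hB c) hm]
  have hfa : 0 ≤ f a := h0.trans (hf (Nat.zero_le a))
  have := key a hab
  calc _ = ‖(∑ m ∈ Ioc a b, (f m : ℂ) * w m - f a * ∑ m ∈ Ioc a b, w m) +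
            f a * ∑ m ∈ Ioc a b, w m‖ := by ring_nf
    _ ≤ (f b - f a) * B + f a * B := by
        refine (norm_add_le _ _).trans (add_le_add this ?_)
        rw [norm_mul, Complex.norm_real, Real.norm_of_nonneg hfa]
        exact mul_le_mul_of_nonneg_left (hB a) hfa
    _ = f b * B := by ring

/-! ### Sums of the kernel along multiples of `β` -/

lemma sum_Ioc_inv_le (n : ℕ) : ∑ m ∈ Ioc 0 n, (1 : ℝ) / m ≤ 1 + Real.log n := by
  have h := harmonic_le_one_add_log n
  rw [harmonic_eq_sum_Icc, show Icc 1 n = Ioc 0 n by ext; simp; omega] at h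
  push_cast at h
  simpa only [one_div] using h

lemma sum_range_inv_le (q : ℕ) : ∑ r ∈ range q, (1 : ℝ) / r ≤ 1 + Real.log q := by
  refine le_trans ?_ (sum_Ioc_inv_le q)
  rw [← sum_filter_add_sum_filter_not (range q) (fun r => r = 0)]
  rw [sum_eq_zero (s := (range q).filter (fun r => r = 0)), zero_add]
  · refine sum_le_sum_of_subset_of_nonneg ?_ fun _ _ _ => by positivity
    intro r hr
    simp only [mem_filter, mem_range] at hr
    simp only [mem_Ioc]; omega
  · intro r hr
    simp [(mem_filter.1 hr).2]

lemma sum_range_inv_sub_le (q : ℕ) : ∑ r ∈ range q, (1 : ℝ) / ((q - r : ℕ) : ℝ) ≤ 1 + Real.log q := by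
  refine le_trans (le_of_eq ?_) (sum_Ioc_inv_le q)
  refine sum_bij' (fun r _ => q - r) (fun r _ => q - r) ?_ ?_ ?_ ?_ ?_ <;>
    simp only [mem_range, mem_Ioc] <;> intros <;> first | omega | trivial

lemma min_le_abs_sub_mul (s m : ℤ) {q r : ℕ} (hr : (r : ℤ) = s % q) (hrq : r < q) :
    ((min r (q - r) : ℕ) : ℤ) ≤ |s - q * m| := by
  have hs : s - q * m = q * (s / q - m) + r := by
    have := Int.mul_ediv_add_emod s q
    rw [hr]; linarith
  rw [hs]
  set w := s / (q : ℤ) - m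
  rcases lt_trichotomy w 0 with hw | hw | hw
  · have : (q : ℤ) * w ≤ -q := by nlinarith
    refine le_trans ?_ (neg_le_abs _)
    have : ((min r (q - r) : ℕ) : ℤ) ≤ q - r := by omega
    linarith
  · rw [hw]; simp
  · have : (q : ℤ) ≤ q * w := by nlinarith
    refine le_trans ?_ (le_abs_self _)
    have : ((min r (q - r) : ℕ) : ℤ) ≤ r := by omega
    linarith

lemma abs_sub_two_le_mul_distInt {q : ℕ} {x δ : ℝ} {s : ℤ} {B : ℝ}
    (hx : q * x = s + δ) (hδ : |δ| ≤ B) :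
    ((|s - q * round x| : ℤ) : ℝ) - B ≤ q * distInt x := by
  have h1 : (q : ℝ) * distInt x = |q * x - q * round x| := by
    rw [distInt, ← mul_sub, abs_mul, abs_of_nonneg (Nat.cast_nonneg q : (0 : ℝ) ≤ q)]
  rw [h1, hx]
  push_cast
  have h2 := abs_sub_abs_le_abs_sub ((s : ℝ) - q * round x) (-δ)
  rw [abs_neg] at h2
  have h3 : (s : ℝ) - q * round x - -δ = s + δ - q * round x := by ring
  rw [h3] at h2
  linarith

lemma geomKernel_le_residue {q r : ℕ} {Y x : ℝ} (hY : 0 ≤ Y) (hrq : r < q)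
    (h : ((min r (q - r) : ℕ) : ℝ) - 2 ≤ q * distInt x) :
    geomKernel Y x ≤ 6 * q * (1 / r + 1 / ((q - r : ℕ) : ℝ)) + (if r ≤ 2 then 2 * Y else 0)
      + (if q ≤ r + 2 then 2 * Y else 0) := by
  have hq : (0 : ℝ) < q := by exact_mod_cast (by omega : 0 < q)
  have hA : 0 ≤ 6 * q * (1 / r + 1 / ((q - r : ℕ) : ℝ)) := by positivity
  have hB : 0 ≤ (if r ≤ 2 then 2 * Y else 0) := by split_ifs <;> positivity
  have hC : 0 ≤ (if q ≤ r + 2 then 2 * Y else 0) := by split_ifs <;> positivity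
  have hK := geomKernel_le hY x
  by_cases h2 : r ≤ 2
  · rw [if_pos h2]; linarith
  by_cases h3 : q ≤ r + 2
  · rw [if_pos h3]; linarith
  set u := min r (q - r) with hu
  have hu3 : 3 ≤ u := by omega
  have hu3' : (3 : ℝ) ≤ u := by exact_mod_cast hu3
  have h4 : geomKernel Y x ≤ 2 / (((u : ℝ) - 2) / q) :=
    geomKernel_le_two_div hY (by apply div_pos <;> linarith) (by rw [div_le_iff₀ hq]; linarith)
  have h5 : 2 / (((u : ℝ) - 2) / q) ≤ 6 * q * (1 / u) := by
    rw [div_div_eq_mul_div, ← mul_div_assoc, div_le_div_iff₀ (by linarith) (by linarith)]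
    nlinarith
  have h6 : (1 : ℝ) / u ≤ 1 / r + 1 / ((q - r : ℕ) : ℝ) := by
    have p1 : (0 : ℝ) ≤ 1 / r := by positivity
    have p2 : (0 : ℝ) ≤ 1 / ((q - r : ℕ) : ℝ) := by positivity
    rcases min_choice r (q - r) with h | h <;> rw [hu, h] <;> linarith
  have h7 := mul_le_mul_of_nonneg_left h6 (by positivity : (0 : ℝ) ≤ 6 * q)
  linarith

lemma sum_geomKernel_block {β : ℝ} {a : ℤ} {q : ℕ} (hq : 0 < q) (hc : IsCoprime a (q : ℤ))
    (hβ : |β - a / q| ≤ 1 / (q : ℝ) ^ 2) {Y L : ℝ} (hY : 0 ≤ Y) (hL : 1 + Real.log q ≤ L) (t : ℤ) :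
    ∑ j ∈ range q, geomKernel Y (β * (t + j)) ≤ 12 * (Y + q * L) := by
  have hq' : (0 : ℝ) < q := by exact_mod_cast hq
  set k : ℤ := ⌊β * t * q⌋
  let r : ℕ → ℕ := fun j => ((k + a * j) % q).toNat
  have hr : ∀ j, (r j : ℤ) = (k + a * j) % q := fun j =>
    Int.toNat_of_nonneg (Int.emod_nonneg _ (by omega))
  have hrq : ∀ j, r j < q := fun j => by
    have := Int.emod_lt_of_pos (k + a * j) (by omega : (0 : ℤ) < q)
    have := hr j
    omega
  let g : ℕ → ℝ := fun r => 6 * q * (1 / r + 1 / ((q - r : ℕ) : ℝ)) + (if r ≤ 2 then 2 * Y else 0)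
      + (if q ≤ r + 2 then 2 * Y else 0)
  have hg : ∀ i, 0 ≤ g i := fun i => by
    simp only [g]
    have hB : 0 ≤ (if i ≤ 2 then 2 * Y else 0) := by split_ifs <;> positivity
    have hC : 0 ≤ (if q ≤ i + 2 then 2 * Y else 0) := by split_ifs <;> positivity
    positivity
  have hpt : ∀ j ∈ range q, geomKernel Y (β * (t + j)) ≤ g (r j) := by
    intro j hj
    have hjq : (j : ℝ) ≤ q := by exact_mod_cast (mem_range.1 hj).le
    refine geomKernel_le_residue hY (hrq j) ?_
    have hx : q * (β * (t + j)) = ((k + a * j : ℤ) : ℝ) +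
        (Int.fract (β * t * q) + (β - a / q) * (q * j)) := by
      have hk : (k : ℝ) + Int.fract (β * t * q) = β * t * q := Int.floor_add_fract _
      have hqj : (β - a / q) * (q * j) = β * (q * j) - a * j := by field_simp
      rw [hqj]; push_cast; linarith
    have hδ : |Int.fract (β * t * q) + (β - a / q) * (q * j)| ≤ 2 := by
      refine (abs_add_le _ _).trans ?_
      rw [abs_mul, abs_of_nonneg (Int.fract_nonneg _),
        abs_of_nonneg (by positivity : (0 : ℝ) ≤ q * j)]
      have h1 : |β - a / q| * (q * j) ≤ 1 / (q : ℝ) ^ 2 * (q * q) := by gcongr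
      have h2 : 1 / (q : ℝ) ^ 2 * (q * q) = 1 := by field_simp
      linarith [(Int.fract_lt_one (β * t * q)).le]
    have h1 := abs_sub_two_le_mul_distInt hx hδ
    have h2 := min_le_abs_sub_mul (k + a * j) (round (β * (t + j))) (hr j) (hrq j)
    have h3 : (((min (r j) (q - r j) : ℕ) : ℤ) : ℝ) ≤ _ := Int.cast_le.2 h2
    rw [Int.cast_natCast] at h3
    linarith
  have hinj : Set.InjOn r (range q : Set ℕ) := by
    intro i hi j hj hij
    simp only [coe_range, Set.mem_Iio] at hi hj
    have h1 : (k + a * i) % q = (k + a * j) % q := by rw [← hr, ← hr, hij]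
    have h2 : (q : ℤ) ∣ a * (i - j) := by
      have h := Int.ModEq.dvd (show Int.ModEq q (k + a * j) (k + a * i) from h1.symm)
      rwa [show k + a * i - (k + a * j) = a * (i - j) by ring] at h
    have h3 : (q : ℤ) ∣ i - j := (hc.symm).dvd_of_dvd_mul_left h2
    have h4 : |(i : ℤ) - j| < q := by rw [abs_lt]; constructor <;> omega
    have := Int.eq_zero_of_abs_lt_dvd h3 h4
    omega
  calc ∑ j ∈ range q, geomKernel Y (β * (t + j)) ≤ ∑ j ∈ range q, g (r j) := sum_le_sum hpt
    _ = ∑ i ∈ (range q).image r, g i := (sum_image hinj).symm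
    _ ≤ ∑ i ∈ range q, g i := sum_le_sum_of_subset_of_nonneg
        (fun i hi => by
          obtain ⟨j, _, rfl⟩ := mem_image.1 hi
          exact mem_range.2 (hrq j)) (fun i _ _ => hg i)
    _ ≤ 6 * q * (L + L) + 2 * (3 * Y) + 2 * (3 * Y) := by
        simp only [g, sum_add_distrib, ← mul_sum, ← sum_filter, sum_const, nsmul_eq_mul]
        have c1 : (#{i ∈ range q | i ≤ 2} : ℝ) ≤ 3 := by
          have : #{i ∈ range q | i ≤ 2} ≤ #(range 3) := card_le_card fun i hi => by
            simp only [mem_filter, mem_range] at hi ⊢; omega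
          rw [card_range] at this; exact_mod_cast this
        have c2 : (#{i ∈ range q | q ≤ i + 2} : ℝ) ≤ 3 := by
          have : #{i ∈ range q | q ≤ i + 2} ≤ #(Ico (q - 2) q) := card_le_card fun i hi => by
            simp only [mem_filter, mem_range, mem_Ico] at hi ⊢; omega
          rw [Nat.card_Ico] at this; exact_mod_cast (this.trans (by omega))
        have h1 := sum_range_inv_le q
        have h2 := sum_range_inv_sub_le q
        gcongr <;> linarith
    _ = 12 * (Y + q * L) := by ring

lemma sum_Ioc_eq_sum_blocks (f : ℕ → ℝ) (q H : ℕ) :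
    ∑ n ∈ Ioc 0 (H * q), f n = ∑ h ∈ range H, ∑ j ∈ range q, f (h * q + j + 1) := by
  have h0 : ∀ n, ∑ n ∈ Ioc 0 n, f n = ∑ n ∈ range n, f (n + 1) := by
    intro n
    induction n with
    | zero => simp
    | succ n ih => rw [sum_Ioc_succ_top (by omega), sum_range_succ, ih]
  rw [h0]
  induction H with
  | zero => simp
  | succ H ih => rw [Nat.add_mul, one_mul, sum_range_add, ih, sum_range_succ]

lemma sum_Ioc_le_sum_blocks {f : ℕ → ℝ} (hf : ∀ n, 0 ≤ f n) {q : ℕ} (hq : 0 < q) (D : ℕ) :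
    ∑ n ∈ Ioc 0 D, f n ≤ ∑ h ∈ range (D / q + 1), ∑ j ∈ range q, f (h * q + j + 1) := by
  rw [← sum_Ioc_eq_sum_blocks]
  refine sum_le_sum_of_subset_of_nonneg (Ioc_subset_Ioc_right ?_) fun n _ _ => hf n
  have := Nat.div_add_mod D q
  have := Nat.mod_lt D hq
  nlinarith

lemma sum_inv_sq_progression_le {n q : ℕ} (hn : 0 < n) (hq : 0 < q) (H : ℕ) :
    ∑ h ∈ range H, 1 / ((n : ℝ) + h * q) ^ 2 ≤ 1 / (n : ℝ) ^ 2 + 1 / (n * q) := by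
  have hn' : (0 : ℝ) < n := by exact_mod_cast hn
  have hq' : (0 : ℝ) < q := by exact_mod_cast hq
  have key : ∀ H : ℕ, ∑ h ∈ range (H + 1), 1 / ((n : ℝ) + h * q) ^ 2 ≤
      1 / (n : ℝ) ^ 2 + 1 / (n * q) - 1 / (q * (n + H * q)) := by
    intro H
    induction H with
    | zero => simp [mul_comm]
    | succ H ih =>
      rw [sum_range_succ]
      set z : ℝ := n + H * q with hz
      have hz' : 0 < z := by positivity
      have e1 : (n : ℝ) + ((H + 1 : ℕ) : ℝ) * q = z + q := by rw [hz]; push_cast; ring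
      rw [e1]
      have : 1 / (z + q) ^ 2 ≤ 1 / (q * z) - 1 / (q * (z + q)) := by
        rw [div_sub_div _ _ (by positivity) (by positivity),
          div_le_div_iff₀ (by positivity) (by positivity)]
        nlinarith [mul_pos (mul_pos hq' hq') (mul_pos hq' (by positivity : 0 < z + q)),
          mul_pos hq' hq', sq_nonneg (z + q), pow_pos hq' 3]
      linarith
  cases H with
  | zero => simp; positivity
  | succ H =>
    refine (key H).trans ?_
    have : (0 : ℝ) ≤ 1 / (q * (n + H * q)) := by positivity
    linarith

lemma sum_geomKernel_bilinear {β : ℝ} {a : ℤ} {q : ℕ} (hq : 0 < q) (hc : IsCoprime a (q : ℤ))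
    (hβ : |β - a / q| ≤ 1 / (q : ℝ) ^ 2) {X L : ℝ} (hX : 0 ≤ X) (hL : 1 + Real.log q ≤ L)
    {n : ℕ} (hn : 0 < n) (D : ℕ) :
    ∑ n' ∈ Ioc 0 D, X / (max n n' : ℕ) * geomKernel (X / (max n n' : ℕ)) (β * (n - n')) ≤
      48 * (X / n) * (X / n + X / q + (D + q) * L) := by
  have hn' : (0 : ℝ) < n := by exact_mod_cast hn
  have hq' : (0 : ℝ) < q := by exact_mod_cast hq
  have hL0 : 1 ≤ L := by linarith [Real.log_natCast_nonneg q]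
  refine (sum_Ioc_le_sum_blocks (fun n' => ?_) hq D).trans ?_
  · have : 0 ≤ X / (max n n' : ℕ) := by positivity
    exact mul_nonneg this (geomKernel_nonneg this _)
  have hblock : ∀ h : ℕ, ∑ j ∈ range q, X / (max n (h * q + j + 1) : ℕ) *
      geomKernel (X / (max n (h * q + j + 1) : ℕ)) (β * (n - (h * q + j + 1 : ℕ))) ≤
      48 * X ^ 2 * (1 / ((n : ℝ) + h * q) ^ 2) + 24 * (X / n) * (q * L) := by
    intro h
    set Y : ℝ := 2 * X / (n + h * q) with hY
    have hY0 : 0 ≤ Y := by positivity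
    calc _ ≤ ∑ j ∈ range q, Y * geomKernel Y (β * (((h * q + 1 - n : ℤ) : ℝ) + j)) := by
          refine sum_le_sum fun j _ => ?_
          rw [← geomKernel_neg Y, show -(β * (((h * q + 1 - n : ℤ) : ℝ) + j)) =
            β * (n - (h * q + j + 1 : ℕ)) by push_cast; ring]
          have h1 : 0 ≤ X / (max n (h * q + j + 1) : ℕ) := by positivity
          have h2 : X / (max n (h * q + j + 1) : ℕ) ≤ Y := by
            have hm : (0 : ℝ) < (max n (h * q + j + 1) : ℕ) := by
              exact_mod_cast lt_max_of_lt_left hn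
            rw [hY, div_le_div_iff₀ hm (by positivity)]
            have : (n : ℝ) + h * q ≤ 2 * (max n (h * q + j + 1) : ℕ) := by
              have : n + h * q ≤ 2 * max n (h * q + j + 1) := by omega
              exact_mod_cast this
            nlinarith
          exact mul_le_mul h2 (geomKernel_mono h1 h2 _) (geomKernel_nonneg h1 _) hY0
      _ ≤ Y * (12 * (Y + q * L)) := by
          rw [← mul_sum]
          exact mul_le_mul_of_nonneg_left (sum_geomKernel_block hq hc hβ hY0 hL _) hY0
      _ = 48 * X ^ 2 * (1 / ((n : ℝ) + h * q) ^ 2) + 12 * Y * (q * L) := by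
          rw [hY]; field_simp; ring
      _ ≤ _ := by
          have : Y ≤ 2 * (X / n) := by
            rw [hY, mul_div_assoc]
            gcongr
            have : (0 : ℝ) ≤ h * q := by positivity
            linarith
          have h3 : 0 ≤ (q : ℝ) * L := by positivity
          nlinarith
  refine (sum_le_sum fun h _ => hblock h).trans ?_
  rw [sum_add_distrib, ← mul_sum, sum_const, card_range, nsmul_eq_mul]
  have h1 := sum_inv_sq_progression_le hn hq (D / q + 1)
  have h2 : (((D / q + 1 : ℕ)) : ℝ) * q ≤ D + q := by
    have := Nat.div_mul_le_self D q
    have : (D / q + 1) * q ≤ D + q := by nlinarith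
    exact_mod_cast this
  calc _ ≤ 48 * X ^ 2 * (1 / (n : ℝ) ^ 2 + 1 / (n * q)) + 24 * (X / n) * ((D + q) * L) := by
        have : (((D / q + 1 : ℕ)) : ℝ) * (24 * (X / n) * (q * L)) =
          24 * (X / n) * (((D / q + 1 : ℕ) : ℝ) * q * L) := by ring
        rw [this]
        gcongr
    _ = 48 * (X / n) * (X / n + X / q) + 24 * (X / n) * ((D + q) * L) := by field_simp
    _ ≤ _ := by
        have : 0 ≤ (X / n) * ((D + q) * L) := by positivity
        linarith

lemma one_le_two_mul_distInt {β : ℝ} {a : ℤ} {q d : ℕ} (hc : IsCoprime a (q : ℤ))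
    (hβ : |β - a / q| ≤ 1 / (q : ℝ) ^ 2) (hd : 0 < d) (hdq : 2 * d ≤ q) :
    1 ≤ 2 * (q : ℝ) * distInt (β * d) := by
  have hq' : (0 : ℝ) < q := by exact_mod_cast (by omega : 0 < q)
  have hx : q * (β * d) = ((a * d : ℤ) : ℝ) + (β - a / q) * (q * d) := by
    push_cast; field_simp; ring
  have hδ : |(β - a / q) * (q * d)| ≤ 1 / 2 := by
    rw [abs_mul, abs_of_nonneg (by positivity : (0 : ℝ) ≤ q * d)]
    have h0 : (2 : ℝ) * d ≤ q := by exact_mod_cast hdq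
    calc |β - a / q| * (q * d) ≤ 1 / (q : ℝ) ^ 2 * (q * (q / 2)) := by gcongr; linarith
      _ = 1 / 2 := by field_simp
  have h1 := abs_sub_two_le_mul_distInt hx hδ
  have h2 : (1 : ℤ) ≤ |a * d - q * round (β * d)| := by
    refine Int.one_le_abs fun h0 => ?_
    have h3 : (q : ℤ) ∣ a * d := ⟨round (β * d), by linarith⟩
    have h4 : (q : ℤ) ∣ d := hc.symm.dvd_of_dvd_mul_left h3
    have := Nat.le_of_dvd hd (Int.natCast_dvd_natCast.1 h4)
    omega
  have h3 : (1 : ℝ) ≤ ((|a * d - q * round (β * d)| : ℤ) : ℝ) := by exact_mod_cast h2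
  linarith

lemma sum_geomKernel_hyperbola {β : ℝ} {a : ℤ} {q : ℕ} (hq : 0 < q) (hc : IsCoprime a (q : ℤ))
    (hβ : |β - a / q| ≤ 1 / (q : ℝ) ^ 2) {X L : ℝ} (hX : 0 ≤ X) (hL : 1 + Real.log q ≤ L)
    (D : ℕ) (hD : 1 + Real.log D ≤ L) :
    ∑ d ∈ Ioc 0 D, geomKernel (X / d) (β * d) ≤ 96 * L * (X / q + D + q) := by
  have hq' : (0 : ℝ) < q := by exact_mod_cast hq
  have hL0 : 1 ≤ L := by linarith [Real.log_natCast_nonneg q]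
  refine (sum_Ioc_le_sum_blocks (fun d => geomKernel_nonneg (by positivity) _) hq D).trans ?_
  have hb0 : ∑ j ∈ range q, geomKernel (X / (0 * q + j + 1 : ℕ)) (β * (0 * q + j + 1 : ℕ)) ≤
      2 * (12 * (2 * q + q * L)) + 12 * (2 * X / q + q * L) := by
    calc _ ≤ ∑ j ∈ range q, (2 * geomKernel (2 * q) (β * (((1 : ℤ) : ℝ) + j)) +
          geomKernel (2 * X / q) (β * (((1 : ℤ) : ℝ) + j))) := by
          refine sum_le_sum fun j _ => ?_
          set d := j + 1
          rw [show (((1 : ℤ) : ℝ) + j) = d by simp only [d]; push_cast; ring,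
            show 0 * q + j + 1 = d by simp only [d]; ring]
          have hd : (0 : ℝ) < d := by positivity
          have k1 := geomKernel_nonneg (by positivity : (0 : ℝ) ≤ 2 * q) (β * d)
          have k2 := geomKernel_nonneg (by positivity : (0 : ℝ) ≤ 2 * X / q) (β * d)
          by_cases hdq : 2 * d ≤ q
          · have := geomKernel_le_two_mul (by positivity : 0 ≤ X / d) (by positivity : 0 < 2 * (q : ℝ))
              (one_le_two_mul_distInt hc hβ (Nat.succ_pos j) hdq)
            linarith
          · have h1 : X / d ≤ 2 * X / q := by
              rw [div_le_div_iff₀ hd hq']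
              have : (q : ℝ) ≤ 2 * d := by exact_mod_cast (by omega : q ≤ 2 * d)
              nlinarith
            have := geomKernel_mono (by positivity) h1 (β * d)
            linarith
      _ ≤ _ := by
          rw [sum_add_distrib, ← mul_sum]
          gcongr
          · exact sum_geomKernel_block hq hc hβ (by positivity) hL 1
          · exact sum_geomKernel_block hq hc hβ (by positivity) hL 1
  have hb : ∀ h : ℕ, ∑ j ∈ range q, geomKernel (X / ((h + 1) * q + j + 1 : ℕ))
      (β * ((h + 1) * q + j + 1 : ℕ)) ≤ 12 * (X / q) * (1 / ((h + 1 : ℕ) : ℝ)) + 12 * (q * L) := by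
    intro h
    set Y : ℝ := X / ((h + 1 : ℕ) * q) with hY
    have hY0 : 0 ≤ Y := by positivity
    calc _ ≤ ∑ j ∈ range q, geomKernel Y (β * ((((h + 1) * q + 1 : ℤ) : ℝ) + j)) := by
          refine sum_le_sum fun j _ => ?_
          rw [show (((h + 1) * q + 1 : ℤ) : ℝ) + j = ((h + 1) * q + j + 1 : ℕ) by push_cast; ring]
          refine geomKernel_mono (by positivity) ?_ _
          rw [hY]
          gcongr
          push_cast
          have : (0 : ℝ) ≤ j := by positivity
          linarith
      _ ≤ 12 * (Y + q * L) := sum_geomKernel_block hq hc hβ hY0 hL _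
      _ = _ := by rw [hY]; field_simp
  rw [sum_range_succ']
  have hs : ∑ h ∈ range (D / q), ∑ j ∈ range q, geomKernel (X / ((h + 1) * q + j + 1 : ℕ))
      (β * ((h + 1) * q + j + 1 : ℕ)) ≤ 12 * (X / q) * L + 12 * (D * L) := by
    refine (sum_le_sum fun h _ => hb h).trans ?_
    rw [sum_add_distrib, ← mul_sum, sum_const, card_range, nsmul_eq_mul]
    have h1 : ∑ h ∈ range (D / q), 1 / ((h + 1 : ℕ) : ℝ) ≤ L := by
      refine le_trans ?_ ((sum_Ioc_inv_le D).trans hD)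
      have := sum_Ioc_eq_sum_blocks (fun n => 1 / (n : ℝ)) 1 (D / q)
      simp only [mul_one, range_one, sum_singleton, add_zero] at this
      rw [← this]
      exact sum_le_sum_of_subset_of_nonneg (Ioc_subset_Ioc_right (Nat.div_le_self D q))
        fun _ _ _ => by positivity
    have h2 : ((D / q : ℕ) : ℝ) * q ≤ D := by exact_mod_cast Nat.div_mul_le_self D q
    have h3 : ((D / q : ℕ) : ℝ) * (12 * (q * L)) = 12 * (((D / q : ℕ) : ℝ) * q * L) := by ring
    rw [h3]
    gcongr
  refine (add_le_add hs hb0).trans ?_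
  have e1 : 0 ≤ X / q := by positivity
  have e2 : 2 * X / q = 2 * (X / q) := by ring
  rw [e2]
  have e3 : X / q ≤ X / q * L := le_mul_of_one_le_right e1 hL0
  have e4 : (q : ℝ) ≤ q * L := le_mul_of_one_le_right hq'.le hL0
  have e5 : 0 ≤ (D : ℝ) * L := by positivity
  nlinarith

/-! ### Vaughan's identity and the exponential sum over `Λ` -/

section

open ArithmeticFunction (vonMangoldt zeta moebius)

lemma sum_Ioc_sum_divisorsAntidiagonal {R : Type*} [AddCommMonoid R] (G : ℕ → ℕ → R) (X : ℕ) :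
    ∑ n ∈ Ioc 0 X, ∑ x ∈ n.divisorsAntidiagonal, G x.1 x.2 =
      ∑ m ∈ Ioc 0 X, ∑ k ∈ Ioc 0 (X / m), G m k := by
  trans ∑ n ∈ Ioc 0 X, ∑ x ∈ Ioc 0 X ×ˢ Ioc 0 X with x.1 * x.2 = n, G x.1 x.2
  · refine sum_congr rfl fun n hn => ?_
    simp only [mem_Ioc] at hn
    rw [Nat.divisorsAntidiagonal_eq_prod_filter_of_le hn.1.ne' hn.2]
  trans ∑ x ∈ Ioc 0 X ×ˢ Ioc 0 X with x.1 * x.2 ≤ X, G x.1 x.2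
  · simp_rw [sum_filter]
    rw [sum_comm]
    exact sum_congr rfl fun _ _ => by simp_all
  rw [sum_filter, sum_product]
  refine sum_congr rfl fun m hm => ?_
  rw [← sum_filter]
  refine sum_congr ?_ fun _ _ => rfl
  ext k
  have hm0 := (mem_Ioc.1 hm).1
  simp only [mem_filter, mem_Ioc, Nat.le_div_iff_mul_le hm0, mul_comm k m]
  constructor
  · rintro ⟨⟨h1, h2⟩, h3⟩; exact ⟨h1, h3⟩
  · rintro ⟨h1, h3⟩; exact ⟨⟨h1, (Nat.le_mul_of_pos_left k hm0).trans h3⟩, h3⟩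

lemma sum_Ioc_convolution_mul (f g : ArithmeticFunction ℝ) (w : ℕ → ℂ) (X : ℕ) :
    ∑ n ∈ Ioc 0 X, ((f * g) n : ℂ) * w n =
      ∑ m ∈ Ioc 0 X, (f m : ℂ) * ∑ k ∈ Ioc 0 (X / m), (g k : ℂ) * w (m * k) := by
  have := sum_Ioc_sum_divisorsAntidiagonal (fun m k => (f m : ℂ) * ((g k : ℂ) * w (m * k))) X
  simp only [mul_sum]
  rw [← this]
  refine sum_congr rfl fun n _ => ?_
  rw [ArithmeticFunction.mul_apply]
  push_cast
  rw [sum_mul]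
  refine sum_congr rfl fun x hx => ?_
  rw [(Nat.mem_divisorsAntidiagonal.1 hx).1]; ring

lemma sum_convolution_div_le {f g : ArithmeticFunction ℝ} (hf : ∀ n, 0 ≤ f n) (hg : ∀ n, 0 ≤ g n)
    (X : ℕ) : ∑ n ∈ Ioc 0 X, (f * g) n / n ≤ (∑ n ∈ Ioc 0 X, f n / n) * ∑ n ∈ Ioc 0 X, g n / n := by
  have := sum_Ioc_sum_divisorsAntidiagonal (fun m k => f m / m * (g k / k)) X
  calc _ = ∑ n ∈ Ioc 0 X, ∑ x ∈ n.divisorsAntidiagonal, f x.1 / x.1 * (g x.2 / x.2) := by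
        refine sum_congr rfl fun n _ => ?_
        rw [ArithmeticFunction.mul_apply, sum_div]
        refine sum_congr rfl fun x hx => ?_
        rw [← (Nat.mem_divisorsAntidiagonal.1 hx).1]; push_cast
        rw [div_mul_div_comm]
    _ ≤ _ := by
        rw [this, sum_mul]
        refine sum_le_sum fun m _ => ?_
        rw [← mul_sum]
        refine mul_le_mul_of_nonneg_left ?_ (div_nonneg (hf m) (Nat.cast_nonneg _))
        exact sum_le_sum_of_subset_of_nonneg (Ioc_subset_Ioc_right (Nat.div_le_self X m))
          fun k _ _ => div_nonneg (hg k) (Nat.cast_nonneg _)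

lemma card_divisors_mul_le (a b : ℕ) :
    #(a * b).divisors ≤ #a.divisors * #b.divisors := by
  rw [Nat.divisors_mul]; exact card_mul_le

lemma zeta_mul_zeta_apply (n : ℕ) :
    ((zeta : ArithmeticFunction ℝ) * zeta) n = #n.divisors := by
  rw [ArithmeticFunction.coe_mul_zeta_apply, card_eq_sum_ones]
  push_cast
  refine sum_congr rfl fun d hd => ?_
  simp [(Nat.pos_of_mem_divisors hd).ne']

lemma sum_card_divisors_sq_div_le {X : ℕ} {L : ℝ} (hL : 1 + Real.log X ≤ L) :
    ∑ n ∈ Ioc 0 X, (#n.divisors : ℝ) ^ 2 / n ≤ L ^ 4 := by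
  set D : ArithmeticFunction ℝ := (zeta : ArithmeticFunction ℝ) * zeta with hD
  have hDn : ∀ n, D n = #n.divisors := zeta_mul_zeta_apply
  have hz : ∀ n, 0 ≤ (zeta : ArithmeticFunction ℝ) n := fun n => by
    simp only [ArithmeticFunction.natCoe_apply]; positivity
  have hD0 : ∀ n, 0 ≤ D n := fun n => by rw [hDn]; positivity
  have h1 : ∑ n ∈ Ioc 0 X, (zeta : ArithmeticFunction ℝ) n / n ≤ L := by
    refine le_trans (le_of_eq ?_) ((sum_Ioc_inv_le X).trans hL)
    refine sum_congr rfl fun n hn => ?_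
    simp [(mem_Ioc.1 hn).1.ne']
  have h10 : 0 ≤ ∑ n ∈ Ioc 0 X, (zeta : ArithmeticFunction ℝ) n / n :=
    sum_nonneg fun n _ => div_nonneg (hz n) (Nat.cast_nonneg _)
  have h2 : ∑ n ∈ Ioc 0 X, D n / n ≤ L * L :=
    (sum_convolution_div_le hz hz X).trans (mul_le_mul h1 h1 h10 (h10.trans h1))
  have h20 : 0 ≤ ∑ n ∈ Ioc 0 X, D n / n :=
    sum_nonneg fun n _ => div_nonneg (hD0 n) (Nat.cast_nonneg _)
  calc _ ≤ ∑ n ∈ Ioc 0 X, (D * D) n / n := by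
        refine sum_le_sum fun n _ => ?_
        refine div_le_div_of_nonneg_right ?_ (Nat.cast_nonneg _)
        rw [ArithmeticFunction.mul_apply, sq]
        calc (#n.divisors : ℝ) * #n.divisors
            = ∑ _x ∈ n.divisorsAntidiagonal, (#n.divisors : ℝ) := by
              rw [Nat.sum_divisorsAntidiagonal (fun _ _ => (#n.divisors : ℝ)), sum_const,
                nsmul_eq_mul]
          _ ≤ _ := by
              refine sum_le_sum fun x hx => ?_
              rw [hDn, hDn, ← (Nat.mem_divisorsAntidiagonal.1 hx).1]
              exact_mod_cast card_divisors_mul_le x.1 x.2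
    _ ≤ (L * L) * (L * L) :=
        (sum_convolution_div_le hD0 hD0 X).trans (mul_le_mul h2 h2 h20 (h20.trans h2))
    _ = L ^ 4 := by ring

lemma arithmeticFunction_sub_apply (f g : ArithmeticFunction ℝ) (n : ℕ) :
    (f - g) n = f n - g n := by
  rw [sub_eq_add_neg, ArithmeticFunction.add_apply, sub_eq_add_neg]
  rfl

lemma sum_vonMangoldt_div_le (X : ℕ) :
    ∑ n ∈ Ioc 0 X, vonMangoldt n / n ≤ 2 * Real.log X := by
  rcases Nat.eq_zero_or_pos X with rfl | hX
  · simp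
  have hX' : (0 : ℝ) < X := by exact_mod_cast hX
  have h := ArithmeticFunction.sum_Ioc_mul_zeta_eq_sum vonMangoldt X
  rw [ArithmeticFunction.vonMangoldt_mul_zeta] at h
  have h1 : ∑ n ∈ Ioc 0 X, ArithmeticFunction.log n ≤ X * Real.log X := by
    calc _ ≤ ∑ _n ∈ Ioc 0 X, Real.log X := by
          refine sum_le_sum fun n hn => ?_
          have hn' := mem_Ioc.1 hn
          rw [ArithmeticFunction.log_apply]
          exact Real.log_le_log (by exact_mod_cast hn'.1) (by exact_mod_cast hn'.2)
      _ = _ := by simp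
  rw [h] at h1
  have h2 : X / 2 * ∑ n ∈ Ioc 0 X, vonMangoldt n / n ≤
      ∑ n ∈ Ioc 0 X, vonMangoldt n * ((X / n : ℕ) : ℝ) := by
    rw [mul_sum]
    refine sum_le_sum fun n hn => ?_
    have hn' := mem_Ioc.1 hn
    have hn0 : (0 : ℝ) < n := by exact_mod_cast hn'.1
    have h3 : (X : ℝ) / 2 / n ≤ ((X / n : ℕ) : ℝ) := by
      rw [div_div, div_le_iff₀ (by positivity)]
      have h4 := Nat.div_add_mod X n
      have h5 := Nat.mod_lt X hn'.1
      have h6 : 1 ≤ X / n := Nat.div_pos hn'.2 hn'.1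
      have : X ≤ (X / n) * (2 * n) := by nlinarith
      exact_mod_cast this
    calc (X : ℝ) / 2 * (vonMangoldt n / n) = vonMangoldt n * ((X : ℝ) / 2 / n) := by ring
      _ ≤ _ := mul_le_mul_of_nonneg_left h3 ArithmeticFunction.vonMangoldt_nonneg
  have h3 := h2.trans h1
  have : X / 2 * ∑ n ∈ Ioc 0 X, vonMangoldt n / n ≤ X / 2 * (2 * Real.log X) := by linarith
  exact le_of_mul_le_mul_left this (by positivity)

/-- The restriction of an arithmetic function to `n ≤ U`. -/
noncomputable def truncate (f : ArithmeticFunction ℝ) (U : ℕ) : ArithmeticFunction ℝ :=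
  ⟨fun n => if n ≤ U then f n else 0, by simp⟩

lemma truncate_apply (f : ArithmeticFunction ℝ) (U n : ℕ) :
    truncate f U n = if n ≤ U then f n else 0 := rfl

lemma vaughan_identity (U V : ℕ) :
    vonMangoldt = truncate vonMangoldt U + truncate (moebius : ArithmeticFunction ℝ) V *
        ArithmeticFunction.log
      - truncate vonMangoldt U * truncate (moebius : ArithmeticFunction ℝ) V *
        (zeta : ArithmeticFunction ℝ)
      + (vonMangoldt - truncate vonMangoldt U) *
        (((moebius : ArithmeticFunction ℝ) - truncate (moebius : ArithmeticFunction ℝ) V) *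
          (zeta : ArithmeticFunction ℝ)) := by
  have h1 : (moebius : ArithmeticFunction ℝ) * (zeta : ArithmeticFunction ℝ) = 1 :=
    ArithmeticFunction.coe_moebius_mul_coe_zeta
  have h2 := ArithmeticFunction.vonMangoldt_mul_zeta
  linear_combination (truncate vonMangoldt U - vonMangoldt) * h1 +
    truncate (moebius : ArithmeticFunction ℝ) V * h2

lemma norm_typeI_sum_le {β : ℝ} {a : ℤ} {q : ℕ} (hq : 0 < q) (hc : IsCoprime a (q : ℤ))
    (hβ : |β - a / q| ≤ 1 / (q : ℝ) ^ 2) {X D : ℕ} {L B₁ B₂ : ℝ} (hL : 1 + Real.log q ≤ L)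
    (hD : 1 + Real.log D ≤ L) (hB₁ : 0 ≤ B₁) (hB₂ : 0 ≤ B₂) {c g : ArithmeticFunction ℝ}
    (hcB : ∀ n ∈ Ioc 0 X, |c n| ≤ B₁) (hcD : ∀ n, D < n → c n = 0)
    (hg : ∀ M ≤ X, ∀ x : ℝ, ‖∑ k ∈ Ioc 0 M, (g k : ℂ) * e (k * x)‖ ≤ B₂ * geomKernel M x) :
    ‖∑ n ∈ Ioc 0 X, ((c * g) n : ℂ) * e (β * n)‖ ≤ B₁ * B₂ * (96 * L * (X / q + D + q)) := by
  rw [sum_Ioc_convolution_mul c g (fun n => e (β * n))]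
  have hK : ∀ d : ℕ, 0 ≤ geomKernel ((X : ℝ) / d) (β * d) := fun d =>
    geomKernel_nonneg (by positivity) _
  calc _ ≤ ∑ d ∈ Ioc 0 X, if d ≤ D then B₁ * B₂ * geomKernel ((X : ℝ) / d) (β * d) else 0 := by
        refine (norm_sum_le _ _).trans (sum_le_sum fun d hd => ?_)
        split_ifs with h
        · rw [norm_mul, Complex.norm_real, Real.norm_eq_abs, mul_assoc]
          refine mul_le_mul (hcB d hd) ?_ (norm_nonneg _) hB₁
          have h1 := hg (X / d) (Nat.div_le_self X d) (β * d)
          have h2 := geomKernel_mono (Nat.cast_nonneg (X / d)) (Nat.cast_div_le (α := ℝ)) (β * d)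
          refine le_trans (le_of_eq ?_) (h1.trans (mul_le_mul_of_nonneg_left h2 hB₂))
          congr 1
          refine sum_congr rfl fun k _ => ?_
          congr 2
          push_cast; ring
        · rw [hcD d (not_le.1 h)]; simp
    _ ≤ ∑ d ∈ Ioc 0 D, B₁ * B₂ * geomKernel ((X : ℝ) / d) (β * d) := by
        rw [← sum_filter]
        refine sum_le_sum_of_subset_of_nonneg (fun d hd => ?_) fun d _ _ => ?_
        · simp only [mem_filter, mem_Ioc] at hd ⊢; omega
        · exact mul_nonneg (mul_nonneg hB₁ hB₂) (hK d)
    _ ≤ _ := by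
        rw [← mul_sum]
        exact mul_le_mul_of_nonneg_left
          (sum_geomKernel_hyperbola hq hc hβ (Nat.cast_nonneg X) hL D hD) (mul_nonneg hB₁ hB₂)

lemma norm_sum_zeta_mul_e_le (M : ℕ) (x : ℝ) :
    ‖∑ k ∈ Ioc 0 M, ((zeta : ArithmeticFunction ℝ) k : ℂ) * e (k * x)‖ ≤ 1 * geomKernel M x := by
  rw [one_mul]
  refine le_trans (le_of_eq ?_) (norm_sum_e_le (a := 0) x (le_refl (M : ℝ)))
  congr 1
  refine sum_congr rfl fun k hk => ?_
  simp [(mem_Ioc.1 hk).1.ne']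

lemma monotone_log_natCast : Monotone fun n : ℕ => Real.log n := by
  intro a b hab
  rcases Nat.eq_zero_or_pos a with rfl | ha
  · simpa using Real.log_natCast_nonneg b
  · exact Real.log_le_log (by exact_mod_cast ha) (by exact_mod_cast hab)

lemma norm_sum_log_mul_e_le (M : ℕ) (x : ℝ) :
    ‖∑ k ∈ Ioc 0 M, (ArithmeticFunction.log k : ℂ) * e (k * x)‖ ≤
      Real.log M * geomKernel M x :=
  norm_sum_monotone_mul_le monotone_log_natCast (by simp) (Nat.zero_le M)
    fun _ => norm_sum_e_le x le_rfl

lemma sum_bilinear_le_of_symm {s : Finset ℕ} {b : ℕ → ℝ} {W : ℕ → ℕ → ℝ}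
    (hW : ∀ n n', 0 ≤ W n n') (hs : ∀ n n', W n n' = W n' n) :
    ∑ n ∈ s, ∑ n' ∈ s, |b n| * |b n'| * W n n' ≤ ∑ n ∈ s, b n ^ 2 * ∑ n' ∈ s, W n n' := by
  have h1 : ∑ n ∈ s, ∑ n' ∈ s, |b n| * |b n'| * W n n' ≤
      ∑ n ∈ s, ∑ n' ∈ s, (b n ^ 2 * W n n' / 2 + b n' ^ 2 * W n n' / 2) := by
    refine sum_le_sum fun n _ => sum_le_sum fun n' _ => ?_
    have := two_mul_le_add_sq |b n| |b n'|
    rw [sq_abs, sq_abs] at this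
    nlinarith [mul_le_mul_of_nonneg_right this (hW n n')]
  refine h1.trans (le_of_eq ?_)
  simp only [sum_add_distrib]
  have h2 : ∑ n ∈ s, ∑ n' ∈ s, b n' ^ 2 * W n n' / 2 = ∑ n ∈ s, ∑ n' ∈ s, b n ^ 2 * W n n' / 2 := by
    rw [sum_comm]
    exact sum_congr rfl fun n _ => sum_congr rfl fun n' _ => by rw [hs]
  rw [h2, ← two_mul, mul_sum]
  refine sum_congr rfl fun n _ => ?_
  rw [mul_sum, mul_sum]
  exact sum_congr rfl fun n' _ => by ring

lemma weighted_second_moment_le (β : ℝ) (X U : ℕ) (hU : 0 < U) (b : ℕ → ℝ) :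
    ∑ m ∈ Ioc U X, (m : ℝ) * ‖∑ n ∈ Ioc 0 (X / m), (b n : ℂ) * e (β * (m * n : ℕ))‖ ^ 2 ≤
      ∑ n ∈ Ioc 0 (X / U), ∑ n' ∈ Ioc 0 (X / U), |b n| * |b n'| *
        ((X : ℝ) / (max n n' : ℕ) * geomKernel ((X : ℝ) / (max n n' : ℕ)) (β * (n - n'))) := by
  set s := Ioc 0 (X / U) with hs
  set G : ℝ := ∑ m ∈ Ioc U X, (m : ℝ) *
    ‖∑ n ∈ Ioc 0 (X / m), (b n : ℂ) * e (β * (m * n : ℕ))‖ ^ 2 with hG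
  have hfil : ∀ m ∈ Ioc U X, Ioc 0 (X / m) = {n ∈ s | m * n ≤ X} := by
    intro m hm
    have hm' := mem_Ioc.1 hm
    ext n
    simp only [hs, mem_filter, mem_Ioc, Nat.le_div_iff_mul_le hU,
      Nat.le_div_iff_mul_le (by omega : 0 < m)]
    constructor
    · rintro ⟨h1, h2⟩; exact ⟨⟨h1, by nlinarith⟩, by linarith⟩
    · rintro ⟨⟨h1, _⟩, h2⟩; exact ⟨h1, by linarith⟩
  have hGc : (G : ℂ) = ∑ n ∈ s, ∑ n' ∈ s, (b n : ℂ) * b n' *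
      ∑ m ∈ Ioc U (X / max n n'), (m : ℂ) * e (m * (β * (n - n'))) := by
    rw [hG]; push_cast
    have hm : ∀ m ∈ Ioc U X, (m : ℂ) *
        (‖∑ n ∈ Ioc 0 (X / m), (b n : ℂ) * e (β * (m * n))‖ : ℂ) ^ 2 =
        ∑ n ∈ s, ∑ n' ∈ s, (b n : ℂ) * b n' *
          (if m * n ≤ X ∧ m * n' ≤ X then (m : ℂ) * e (m * (β * (n - n'))) else 0) := by
      intro m hm
      rw [← Complex.mul_conj', hfil m hm, sum_filter, map_sum, sum_mul_sum, mul_sum]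
      refine sum_congr rfl fun n _ => ?_
      rw [mul_sum]
      refine sum_congr rfl fun n' _ => ?_
      by_cases h1 : m * n ≤ X <;> by_cases h2 : m * n' ≤ X <;> simp only [h1, h2, if_true, if_false,
        and_false, and_true, map_zero, mul_zero, zero_mul]
      rw [map_mul, Complex.conj_ofReal, conj_e,
        show (m : ℝ) * (β * (n - n')) = β * (m * n) + -(β * (m * n')) by ring, e_add]
      ring
    rw [sum_congr rfl hm, sum_comm]
    refine sum_congr rfl fun n hn => ?_
    rw [sum_comm]
    refine sum_congr rfl fun n' hn' => ?_
    rw [← mul_sum, ← sum_filter]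
    congr 1
    refine sum_congr ?_ fun _ _ => rfl
    ext m
    have hn0 := (mem_Ioc.1 hn).1
    have hmax : 0 < max n n' := by omega
    simp only [mem_filter, mem_Ioc, Nat.le_div_iff_mul_le hmax]
    constructor
    · rintro ⟨⟨h1, _⟩, h2, h3⟩
      refine ⟨h1, ?_⟩
      rcases max_choice n n' with h | h <;> rw [h] <;> assumption
    · rintro ⟨h1, h2⟩
      have h3 : m * n ≤ X := (Nat.mul_le_mul_left m (le_max_left n n')).trans h2
      have h4 : m * n' ≤ X := (Nat.mul_le_mul_left m (le_max_right n n')).trans h2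
      exact ⟨⟨h1, by nlinarith⟩, h3, h4⟩
  have hG0 : 0 ≤ G := sum_nonneg fun m _ => by positivity
  have : G = ‖(G : ℂ)‖ := by rw [Complex.norm_real, Real.norm_of_nonneg hG0]
  rw [this, hGc]
  refine (norm_sum_le _ _).trans (sum_le_sum fun n _ => ?_)
  refine (norm_sum_le _ _).trans (sum_le_sum fun n' _ => ?_)
  rw [norm_mul, norm_mul, Complex.norm_real, Complex.norm_real, Real.norm_eq_abs, Real.norm_eq_abs]
  refine mul_le_mul_of_nonneg_left ?_ (by positivity)
  have hY : (0 : ℝ) ≤ (X : ℝ) / (max n n' : ℕ) := by positivity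
  have hK := geomKernel_nonneg hY (β * (n - n'))
  rcases le_total U (X / max n n') with h | h
  · have h1 := norm_sum_monotone_mul_le (f := fun m : ℕ => (m : ℝ)) (a := U)
      (w := fun m => e (m * (β * (n - n')))) Nat.mono_cast (by simp) h
      (fun c => norm_sum_e_le (a := c) (β * (n - n')) (Nat.cast_div_le (α := ℝ)))
    simp only [Complex.ofReal_natCast] at h1
    refine h1.trans (mul_le_mul_of_nonneg_right Nat.cast_div_le hK)
  · rw [Ioc_eq_empty_of_le h]; simp only [sum_empty, norm_zero]; positivity

lemma norm_typeII_sum_sq_le {β : ℝ} {a : ℤ} {q : ℕ} (hq : 0 < q) (hc : IsCoprime a (q : ℤ))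
    (hβ : |β - a / q| ≤ 1 / (q : ℝ) ^ 2) {X U V : ℕ} {L : ℝ} (hL : 1 + Real.log q ≤ L)
    (hLX : 1 + Real.log X ≤ L) (hU : 0 < U) (hV : 0 < V) {f b : ArithmeticFunction ℝ}
    (hfU : ∀ n ≤ U, f n = 0) (hf : ∀ n, |f n| ≤ vonMangoldt n) (hbV : ∀ n ≤ V, b n = 0)
    (hb : ∀ n, |b n| ≤ #n.divisors) :
    ‖∑ n ∈ Ioc 0 X, ((f * b) n : ℂ) * e (β * n)‖ ^ 2 ≤
      96 * L ^ 6 * X * (X / V + X / q + (X / U + q) * L) := by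
  have hL1 : 1 ≤ L := by linarith [Real.log_natCast_nonneg q]
  rw [sum_Ioc_convolution_mul f b (fun n => e (β * n))]
  set I : ℕ → ℂ := fun m => ∑ n ∈ Ioc 0 (X / m), (b n : ℂ) * e (β * (m * n : ℕ)) with hI
  have hsub : Ioc U X ⊆ Ioc 0 X := Ioc_subset_Ioc_left (Nat.zero_le U)
  have h1 : ∑ m ∈ Ioc 0 X, (f m : ℂ) * I m = ∑ m ∈ Ioc U X, (f m : ℂ) * I m := by
    refine (sum_subset hsub fun m hm hm' => ?_).symm
    have : m ≤ U := by simp only [mem_Ioc] at hm hm'; omega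
    rw [hfU m this]; simp
  have h2 : ‖∑ m ∈ Ioc U X, (f m : ℂ) * I m‖ ^ 2 ≤
      (∑ m ∈ Ioc U X, f m ^ 2 / m) * ∑ m ∈ Ioc U X, (m : ℝ) * ‖I m‖ ^ 2 := by
    have h3 : ‖∑ m ∈ Ioc U X, (f m : ℂ) * I m‖ ≤
        ∑ m ∈ Ioc U X, |f m| / √m * (√m * ‖I m‖) := by
      refine (norm_sum_le _ _).trans (sum_le_sum fun m hm => ?_)
      have hm0 : (0 : ℝ) < m := by
        have := mem_Ioc.1 hm
        exact_mod_cast (by omega : 0 < m)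
      rw [norm_mul, Complex.norm_real, Real.norm_eq_abs]
      have := Real.sqrt_pos.2 hm0
      apply le_of_eq; field_simp
    refine (pow_le_pow_left₀ (norm_nonneg _) h3 2).trans ?_
    refine (sum_mul_sq_le_sq_mul_sq _ _ _).trans (le_of_eq ?_)
    congr 1 <;> refine sum_congr rfl fun m _ => ?_
    · rw [div_pow, sq_abs, Real.sq_sqrt (Nat.cast_nonneg m)]
    · rw [mul_pow, Real.sq_sqrt (Nat.cast_nonneg m)]
  have h3 : ∑ m ∈ Ioc U X, f m ^ 2 / m ≤ 2 * L ^ 2 := by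
    calc _ ≤ ∑ m ∈ Ioc U X, L * (vonMangoldt m / m) := by
          refine sum_le_sum fun m hm => ?_
          have hm' := mem_Ioc.1 hm
          rw [← mul_div_assoc]
          refine div_le_div_of_nonneg_right ?_ (Nat.cast_nonneg m)
          have h4 : vonMangoldt m ≤ L := by
            have := ArithmeticFunction.vonMangoldt_le_log (n := m)
            have := monotone_log_natCast hm'.2
            simp only at this
            linarith
          rw [← sq_abs, sq]
          exact mul_le_mul ((hf m).trans h4) (hf m) (abs_nonneg _) (by linarith)
      _ ≤ L * ∑ m ∈ Ioc 0 X, vonMangoldt m / m := by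
          rw [← mul_sum]
          refine mul_le_mul_of_nonneg_left ?_ (by linarith)
          exact sum_le_sum_of_subset_of_nonneg hsub fun m _ _ =>
            div_nonneg ArithmeticFunction.vonMangoldt_nonneg (Nat.cast_nonneg m)
      _ ≤ L * (2 * L) := by
          refine mul_le_mul_of_nonneg_left ((sum_vonMangoldt_div_le X).trans ?_) (by linarith)
          linarith
      _ = _ := by ring
  set Z : ℝ := (X : ℝ) / V + X / q + (X / U + q) * L with hZ
  have hZ0 : 0 ≤ Z := by positivity
  have h4 : ∑ m ∈ Ioc U X, (m : ℝ) * ‖I m‖ ^ 2 ≤ 48 * X * Z * L ^ 4 := by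
    refine (weighted_second_moment_le β X U hU b).trans ?_
    refine (sum_bilinear_le_of_symm (W := fun n n' => (X : ℝ) / (max n n' : ℕ) *
      geomKernel ((X : ℝ) / (max n n' : ℕ)) (β * (n - n'))) (fun n n' => ?_) fun n n' => ?_).trans ?_
    · exact mul_nonneg (by positivity) (geomKernel_nonneg (by positivity) _)
    · rw [max_comm, ← geomKernel_neg]; congr 2; ring
    calc _ ≤ ∑ n ∈ Ioc 0 (X / U), 48 * X * Z * ((#n.divisors : ℝ) ^ 2 / n) := by
          refine sum_le_sum fun n hn => ?_
          rcases le_or_gt n V with h | h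
          · rw [hbV n h]
            simp only [ne_eq, OfNat.ofNat_ne_zero, not_false_eq_true, zero_pow, zero_mul]
            positivity
          have hn0 := (mem_Ioc.1 hn).1
          have hn0' : (0 : ℝ) < n := by exact_mod_cast hn0
          have hV' : (0 : ℝ) < V := by exact_mod_cast hV
          have k1 := sum_geomKernel_bilinear hq hc hβ (Nat.cast_nonneg X) hL hn0 (X / U)
          have k2 : (X : ℝ) / n + X / q + (((X / U : ℕ) : ℝ) + q) * L ≤ Z := by
            rw [hZ]
            gcongr
            exact Nat.cast_div_le
          have k3 : b n ^ 2 ≤ (#n.divisors : ℝ) ^ 2 := by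
            rw [← sq_abs]; exact pow_le_pow_left₀ (abs_nonneg _) (hb n) 2
          calc _ ≤ (#n.divisors : ℝ) ^ 2 * (48 * (X / n) * Z) := by
                refine mul_le_mul k3 (k1.trans ?_) (sum_nonneg fun n' _ =>
                  mul_nonneg (by positivity) (geomKernel_nonneg (by positivity) _)) (by positivity)
                exact mul_le_mul_of_nonneg_left k2 (by positivity)
            _ = _ := by ring
      _ ≤ _ := by
          rw [← mul_sum]
          refine mul_le_mul_of_nonneg_left (le_trans ?_ (sum_card_divisors_sq_div_le hLX))
            (by positivity)
          exact sum_le_sum_of_subset_of_nonneg (Ioc_subset_Ioc_right (Nat.div_le_self X U))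
            fun n _ _ => by positivity
  calc _ = ‖∑ m ∈ Ioc U X, (f m : ℂ) * I m‖ ^ 2 := by rw [← h1]
    _ ≤ 2 * L ^ 2 * (48 * X * Z * L ^ 4) := h2.trans (mul_le_mul h3 h4 (sum_nonneg fun m _ => by
        positivity) (by positivity))
    _ = _ := by ring

lemma norm_sum_vonMangoldt_mul_e_le {β : ℝ} {a : ℤ} {q : ℕ} (hq : 0 < q)
    (hc : IsCoprime a (q : ℤ)) (hβ : |β - a / q| ≤ 1 / (q : ℝ) ^ 2) {X U : ℕ} {L : ℝ}
    (hqX : q ≤ X) (hLX : 1 + Real.log X ≤ L) (hU : 0 < U) (hUX : U * U ≤ X) :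
    ‖∑ n ∈ Ioc 0 X, (vonMangoldt n : ℂ) * e (β * n)‖ ≤
      U * L + 2 * (96 * L ^ 2 * (X / q + U * U + q)) +
        √(96 * L ^ 6 * X * (X / U + X / q + (X / U + q) * L)) := by
  have hlog : ∀ n ≤ X, 1 + Real.log n ≤ L := fun n hn => by
    have := monotone_log_natCast hn
    simp only at this
    linarith
  have hL1 : 1 ≤ L := by linarith [Real.log_natCast_nonneg X]
  have hUU : U ≤ U * U := Nat.le_mul_self U
  set μ' : ArithmeticFunction ℝ := (moebius : ArithmeticFunction ℝ) with hμ
  have hμ1 : ∀ n, |μ' n| ≤ 1 := fun n => by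
    rw [hμ, ArithmeticFunction.intCoe_apply]
    exact_mod_cast ArithmeticFunction.abs_moebius_le_one
  have b1 : ‖∑ n ∈ Ioc 0 X, (truncate vonMangoldt U n : ℂ) * e (β * n)‖ ≤ U * L := by
    calc _ ≤ ∑ n ∈ Ioc 0 X, if n ≤ U then L else 0 := by
          refine (norm_sum_le _ _).trans (sum_le_sum fun n hn => ?_)
          rw [norm_mul, norm_e, mul_one, Complex.norm_real, truncate_apply]
          split_ifs with h
          · rw [Real.norm_of_nonneg ArithmeticFunction.vonMangoldt_nonneg]
            have := ArithmeticFunction.vonMangoldt_le_log (n := n)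
            linarith [hlog n (mem_Ioc.1 hn).2]
          · simp
      _ ≤ ∑ n ∈ Ioc 0 U, L := by
          rw [← sum_filter]
          refine sum_le_sum_of_subset_of_nonneg (fun d hd => ?_) fun d _ _ => by linarith
          simp only [mem_filter, mem_Ioc] at hd ⊢; omega
      _ = U * L := by simp
  have b2 : ‖∑ n ∈ Ioc 0 X, ((truncate μ' U * ArithmeticFunction.log) n : ℂ) * e (β * n)‖ ≤
      1 * L * (96 * L * (X / q + (U * U : ℕ) + q)) := by
    refine norm_typeI_sum_le hq hc hβ (hlog q hqX) (hlog _ hUX) zero_le_one (by linarith) ?_ ?_ ?_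
    · intro n _
      rw [truncate_apply]
      split_ifs
      · exact hμ1 n
      · simp
    · intro n hn
      rw [truncate_apply, if_neg (by omega)]
    · intro M hM x
      refine (norm_sum_log_mul_e_le M x).trans (mul_le_mul_of_nonneg_right ?_
        (geomKernel_nonneg (Nat.cast_nonneg M) x))
      linarith [hlog M hM]
  have b3 : ‖∑ n ∈ Ioc 0 X, ((truncate vonMangoldt U * truncate μ' U *
      (zeta : ArithmeticFunction ℝ)) n : ℂ) * e (β * n)‖ ≤
      L * 1 * (96 * L * (X / q + (U * U : ℕ) + q)) := by
    refine norm_typeI_sum_le hq hc hβ (hlog q hqX) (hlog _ hUX) (by linarith) zero_le_one ?_ ?_ ?_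
    · intro n hn
      rw [ArithmeticFunction.mul_apply]
      calc _ ≤ ∑ x ∈ n.divisorsAntidiagonal, vonMangoldt x.1 *
            (zeta : ArithmeticFunction ℝ) x.2 := by
            refine (abs_sum_le_sum_abs _ _).trans (sum_le_sum fun x hx => ?_)
            have hx2 : x.2 ≠ 0 := fun h => by
              have := Nat.mem_divisorsAntidiagonal.1 hx
              rw [h] at this; simp at this; omega
            rw [abs_mul, ArithmeticFunction.natCoe_apply, ArithmeticFunction.zeta_apply_ne hx2]
            simp only [truncate_apply]
            have hv : 0 ≤ vonMangoldt x.1 := ArithmeticFunction.vonMangoldt_nonneg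
            refine mul_le_mul ?_ ?_ (abs_nonneg _) hv
            · split_ifs
              · rw [abs_of_nonneg hv]
              · simp [hv]
            · split_ifs
              · simpa using hμ1 x.2
              · simp
        _ = Real.log n := by
            rw [← ArithmeticFunction.mul_apply, ArithmeticFunction.vonMangoldt_mul_zeta,
              ArithmeticFunction.log_apply]
        _ ≤ L := by linarith [hlog n (mem_Ioc.1 hn).2]
    · intro n hn
      rw [ArithmeticFunction.mul_apply]
      refine sum_eq_zero fun x hx => ?_
      have hx1 := (Nat.mem_divisorsAntidiagonal.1 hx).1
      simp only [truncate_apply]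
      by_cases h1 : x.1 ≤ U
      · have h2 : ¬ x.2 ≤ U := fun h2 => by
          have := Nat.mul_le_mul h1 h2
          omega
        simp [h2]
      · simp [h1]
    · exact fun M _ x => norm_sum_zeta_mul_e_le M x
  have b4 : ‖∑ n ∈ Ioc 0 X, (((vonMangoldt - truncate vonMangoldt U) *
      ((μ' - truncate μ' U) * (zeta : ArithmeticFunction ℝ)) : ArithmeticFunction ℝ) n : ℂ) *
        e (β * n)‖ ≤ √(96 * L ^ 6 * X * (X / U + X / q + (X / U + q) * L)) := by
    have hμs : ∀ n, (μ' - truncate μ' U) n = if n ≤ U then 0 else μ' n := fun n => by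
      rw [arithmeticFunction_sub_apply, truncate_apply]; split_ifs <;> simp
    have hΛs : ∀ n, (vonMangoldt - truncate vonMangoldt U) n =
        if n ≤ U then 0 else vonMangoldt n := fun n => by
      rw [arithmeticFunction_sub_apply, truncate_apply]; split_ifs <;> simp
    refine Real.le_sqrt_of_sq_le ?_
    refine norm_typeII_sum_sq_le hq hc hβ (hlog q hqX) hLX hU hU ?_ ?_ ?_ ?_
    · intro n hn; rw [hΛs, if_pos hn]
    · intro n
      have hv : 0 ≤ vonMangoldt n := ArithmeticFunction.vonMangoldt_nonneg
      rw [hΛs]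
      split_ifs
      · simp [hv]
      · rw [abs_of_nonneg hv]
    · intro n hn
      rw [ArithmeticFunction.coe_mul_zeta_apply]
      refine sum_eq_zero fun d hd => ?_
      rw [hμs, if_pos ((Nat.divisor_le hd).trans hn)]
    · intro n
      rw [ArithmeticFunction.coe_mul_zeta_apply]
      refine (abs_sum_le_sum_abs _ _).trans ?_
      rw [card_eq_sum_ones]; push_cast
      refine sum_le_sum fun d _ => ?_
      rw [hμs]
      split_ifs
      · simp
      · exact hμ1 d
  have hsplit : ∑ n ∈ Ioc 0 X, (vonMangoldt n : ℂ) * e (β * n) =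
      ∑ n ∈ Ioc 0 X, (truncate vonMangoldt U n : ℂ) * e (β * n) +
      ∑ n ∈ Ioc 0 X, ((truncate μ' U * ArithmeticFunction.log) n : ℂ) * e (β * n) -
      ∑ n ∈ Ioc 0 X, ((truncate vonMangoldt U * truncate μ' U *
        (zeta : ArithmeticFunction ℝ)) n : ℂ) * e (β * n) +
      ∑ n ∈ Ioc 0 X, (((vonMangoldt - truncate vonMangoldt U) *
        ((μ' - truncate μ' U) * (zeta : ArithmeticFunction ℝ)) : ArithmeticFunction ℝ) n : ℂ) *
        e (β * n) := by
    rw [← sum_add_distrib, ← sum_sub_distrib, ← sum_add_distrib]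
    refine sum_congr rfl fun n _ => ?_
    have h := congrArg (fun f : ArithmeticFunction ℝ => f n) (vaughan_identity U U)
    rw [← hμ] at h
    simp only [ArithmeticFunction.add_apply, arithmeticFunction_sub_apply] at h
    rw [h]
    push_cast
    ring
  rw [hsplit]
  refine (norm_add_le _ _).trans (add_le_add ((norm_sub_le _ _).trans ?_) b4)
  refine (add_le_add ((norm_add_le _ _).trans (add_le_add b1 b2)) b3).trans (le_of_eq ?_)
  push_cast; ring

end

/-! ### The sum over primes on the minor arcs -/

section

open ArithmeticFunction (vonMangoldt)

lemma norm_Ftilde_sub_le {A : ℝ} (hA : 1 ≤ A) (α : ℝ) :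
    ‖(∑ n ∈ Ioc 0 ⌊A⌋₊, (vonMangoldt n : ℂ) * e (2 * α * n)) - Ftilde A α‖ ≤
      2 * √A * Real.log A + Real.log 2 := by
  have hF : Ftilde A α = ∑ n ∈ Ioc 0 ⌊A⌋₊,
      if n.Prime ∧ 2 < n then (Real.log n : ℂ) * e (α * (2 * n)) else 0 := by
    rw [Ftilde, ← sum_filter]
    refine sum_congr ?_ fun _ _ => rfl
    ext n
    simp only [mem_filter, mem_range, mem_Ioc]
    constructor
    · rintro ⟨h1, h2, h3, h4⟩
      exact ⟨⟨by omega, by omega⟩, h2, h3⟩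
    · rintro ⟨⟨h1, h2⟩, h3, h4⟩
      exact ⟨by omega, h3, h4, (Nat.le_floor_iff (by linarith)).1 h2⟩
  have hterm : ∀ n ∈ Ioc 0 ⌊A⌋₊, ‖(vonMangoldt n : ℂ) * e (2 * α * n) -
      (if n.Prime ∧ 2 < n then (Real.log n : ℂ) * e (α * (2 * n)) else 0)‖ ≤
        (if ¬ n.Prime then vonMangoldt n else 0) + if n = 2 then Real.log 2 else 0 := by
    intro n _
    have hv : 0 ≤ vonMangoldt n := ArithmeticFunction.vonMangoldt_nonneg
    have hl : 0 ≤ Real.log 2 := Real.log_nonneg (by norm_num)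
    have hle : 0 ≤ if n = 2 then Real.log 2 else 0 := by split_ifs <;> simp [hl]
    by_cases hp : n.Prime
    · rcases hp.two_le.eq_or_lt with h2 | h2
      · subst h2
        rw [if_neg (by simp), if_neg (by simpa using hp), if_pos rfl, sub_zero, zero_add,
          norm_mul, norm_e, mul_one, Complex.norm_real, Real.norm_of_nonneg hv,
          ArithmeticFunction.vonMangoldt_apply_prime hp, Nat.cast_ofNat]
      · rw [if_pos ⟨hp, h2⟩, ArithmeticFunction.vonMangoldt_apply_prime hp,
          show 2 * α * n = α * (2 * n) by ring]
        simp [hp, h2.ne']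
    · simpa [hp, norm_e, abs_of_nonneg hv] using hle
  rw [hF, ← sum_sub_distrib]
  refine (norm_sum_le _ _).trans ((sum_le_sum hterm).trans ?_)
  rw [sum_add_distrib, ← sum_filter, ← Chebyshev.psi_sub_theta_eq_sum_not_prime]
  refine add_le_add (Chebyshev.psi_sub_theta_le hA) ?_
  rw [sum_ite_eq']
  split_ifs
  · exact le_rfl
  · exact Real.log_nonneg (by norm_num)

lemma norm_Ftilde_le {A L Q α : ℝ} {a : ℤ} {q : ℕ} (hc : IsCoprime a (q : ℤ))
    (hα : |2 * α - a / q| ≤ 1 / (q : ℝ) ^ 2) (hQ : 2 ≤ Q) (hL : 1 ≤ L)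
    (hLA : 1 + Real.log A ≤ L) (hA : 9 * L ^ 2 * Q ^ 3 ≤ A) (hQq : Q / 2 ≤ q)
    (hqA : q * L ≤ A / Q) :
    ‖Ftilde A α‖ ≤ 800 * L ^ 3 * (A / √Q) := by
  have hQ0 : 0 < Q := by linarith
  have hL0 : 0 < L := by linarith
  have hq0 : (0 : ℝ) < q := by linarith
  have hq : 0 < q := by exact_mod_cast hq0
  have hLL : 1 ≤ L ^ 2 := one_le_pow₀ hL
  have hA1 : 1 ≤ A := by
    refine le_trans ?_ hA
    have : (1 : ℝ) ≤ Q ^ 3 := one_le_pow₀ (by linarith)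
    nlinarith
  have hA0 : 0 < A := by linarith
  set T := A / Q with hT
  have hAT : A = T * Q := by rw [hT]; field_simp
  have hT0 : 0 < T := by positivity
  have hT9 : 9 * L ^ 2 * Q ^ 2 ≤ T := by
    rw [hT, le_div_iff₀ hQ0]; linarith
  have hT1 : 1 ≤ T := by
    have : (1 : ℝ) ≤ Q ^ 2 := one_le_pow₀ (by linarith)
    nlinarith
  have hLQ2 : L ^ 2 * Q ≤ L ^ 2 * Q ^ 2 :=
    mul_le_mul_of_nonneg_left (le_self_pow₀ (by linarith) two_ne_zero) (by positivity)
  have hLQ0 : 0 ≤ L ^ 2 * Q ^ 2 := by positivity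
  have hTA : T ≤ A / 2 := by rw [hAT]; nlinarith
  set X := ⌊A⌋₊ with hX
  have hXA : (X : ℝ) ≤ A := Nat.floor_le hA0.le
  have hAX : A / 2 ≤ X := by
    have h1 := Nat.lt_floor_add_one A
    have h2 : (1 : ℝ) ≤ X := by
      exact_mod_cast (Nat.one_le_floor_iff A).2 hA1
    rw [← hX] at h1
    linarith
  have hX0 : (0 : ℝ) < X := by linarith
  have hqT : (q : ℝ) ≤ T := le_trans (le_mul_of_one_le_right hq0.le hL) hqA
  have hqX : q ≤ X := by
    have : (q : ℝ) ≤ X := by linarith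
    exact_mod_cast this
  have hLX : 1 + Real.log X ≤ L := by
    linarith [Real.log_le_log hX0 hXA]
  set U := ⌈L * Q⌉₊ with hU
  have hLQ : 1 ≤ L * Q := by nlinarith
  have hUl : L * Q ≤ U := Nat.le_ceil _
  have hUu : (U : ℝ) ≤ 2 * (L * Q) := by
    linarith [Nat.ceil_lt_add_one (show 0 ≤ L * Q by linarith)]
  have hU0 : (0 : ℝ) < U := by linarith
  have hUU : (U : ℝ) * U ≤ T := by
    calc (U : ℝ) * U ≤ (2 * (L * Q)) * (2 * (L * Q)) := by gcongr
      _ ≤ 9 * L ^ 2 * Q ^ 2 := by rw [← sub_nonneg]; ring_nf; positivity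
      _ ≤ T := hT9
  have hUX : U * U ≤ X := by
    have : (U : ℝ) * U ≤ X := by linarith
    exact_mod_cast this
  have hUL : (U : ℝ) * L ≤ T := by
    refine le_trans ?_ hT9
    calc (U : ℝ) * L ≤ 2 * (L * Q) * L := by gcongr
      _ = 2 * L ^ 2 * Q := by ring
      _ ≤ 9 * L ^ 2 * Q ^ 2 := by
        linarith
  have hXq : (X : ℝ) / q ≤ 2 * T := by
    rw [div_le_iff₀ hq0]
    calc (X : ℝ) ≤ T * Q := by rw [← hAT]; exact hXA
      _ ≤ 2 * T * q := by nlinarith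
  have hXU : (X : ℝ) / U * L ≤ T := by
    rw [div_mul_eq_mul_div, div_le_iff₀ hU0]
    calc (X : ℝ) * L ≤ T * Q * L := by rw [← hAT]; gcongr
      _ = T * (L * Q) := by ring
      _ ≤ T * U := by gcongr
  have hXU' : (X : ℝ) / U ≤ T :=
    le_trans (le_mul_of_one_le_right (by positivity) hL) hXU
  have hR0 : 0 < √Q := Real.sqrt_pos.2 hQ0
  have hTR : T ≤ A / √Q := by
    rw [hT]
    refine div_le_div_of_nonneg_left hA0.le hR0 ?_
    rw [Real.sqrt_le_left hQ0.le]
    nlinarith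
  have hmain := norm_sum_vonMangoldt_mul_e_le hq hc hα hqX hLX (Nat.ceil_pos.2 (by linarith)) hUX
  have hsq : √(96 * L ^ 6 * X * (X / U + X / q + (X / U + q) * L)) ≤ 22 * L ^ 3 * (A / √Q) := by
    rw [Real.sqrt_le_left (by positivity)]
    calc _ ≤ 96 * L ^ 6 * A * (T + 2 * T + (T + T)) := by
          rw [add_mul]; gcongr
      _ = 480 * L ^ 6 * A * T := by ring
      _ ≤ 484 * L ^ 6 * A * T := by gcongr; norm_num
      _ = _ := by
          rw [mul_pow, mul_pow, div_pow, Real.sq_sqrt hQ0.le, hT]; ring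
  have hpp : 2 * √A * Real.log A ≤ T := by
    have h1 : √A * (2 * L) ≤ T := by
      have : (2 * L) ^ 2 * Q ≤ T := by
        rw [mul_pow]
        linarith
      refine (abs_le_of_sq_le_sq' ?_ hT0.le).2
      rw [mul_pow, Real.sq_sqrt hA0.le]
      calc A * (2 * L) ^ 2 = T * ((2 * L) ^ 2 * Q) := by rw [hAT]; ring
        _ ≤ T * T := by gcongr
        _ = T ^ 2 := by ring
    calc _ = √A * (2 * Real.log A) := by ring
      _ ≤ √A * (2 * L) := by gcongr; linarith
      _ ≤ T := h1
  have hl2 : Real.log 2 ≤ T := by linarith [Real.log_two_lt_d9]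
  have hdiff := norm_Ftilde_sub_le hA1 α
  rw [norm_sub_rev] at hdiff
  have htri := norm_le_norm_add_norm_sub' (Ftilde A α)
    (∑ n ∈ Ioc 0 ⌊A⌋₊, (vonMangoldt n : ℂ) * e (2 * α * n))
  have hsec : 2 * (96 * L ^ 2 * ((X : ℝ) / q + U * U + q)) ≤ 768 * L ^ 2 * T := by
    calc _ ≤ 2 * (96 * L ^ 2 * (2 * T + T + T)) := by gcongr
      _ = _ := by ring
  have hL3 : L ^ 2 ≤ L ^ 3 := pow_le_pow_right₀ hL (by norm_num)
  calc ‖Ftilde A α‖ ≤ T + 768 * L ^ 2 * T + 22 * L ^ 3 * (A / √Q) + (T + T) := by linarith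
    _ = (3 + 768 * L ^ 2) * T + 22 * L ^ 3 * (A / √Q) := by ring
    _ ≤ (778 * L ^ 3) * (A / √Q) + 22 * L ^ 3 * (A / √Q) := by
        gcongr
        linarith
    _ = _ := by ring

end

/-! ### Dirichlet approximation on the minor arcs -/

lemma exists_approx_of_mem_Minor {ε lam : ℝ} {N : ℕ} {α : ℝ} (hQ : 2 ≤ Qof lam N)
    (hτ : 2 * Qof lam N ≤ tauof ε lam N) (hα : α ∈ Minor ε lam N) :
    ∃ (a : ℤ) (q : ℕ), IsCoprime a (q : ℤ) ∧ |2 * α - a / q| ≤ 1 / (q : ℝ) ^ 2 ∧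
      Qof lam N / 2 ≤ q ∧ (q : ℝ) ≤ tauof ε lam N := by
  obtain ⟨⟨hα1, hα2⟩, hM⟩ := hα
  set τ := tauof ε lam N with hτd
  set Q := Qof lam N with hQd
  have hτ0 : 0 < τ := by linarith
  have hn : 0 < ⌊τ⌋₊ := Nat.floor_pos.2 (by linarith)
  obtain ⟨r, hr, hrn⟩ := Real.exists_rat_abs_sub_le_and_den_le (2 * α) hn
  have hd0 : (0 : ℝ) < r.den := by exact_mod_cast r.den_pos
  have hd1 : (1 : ℝ) ≤ r.den := by exact_mod_cast r.den_pos
  have hnτ : τ < ⌊τ⌋₊ + 1 := Nat.lt_floor_add_one τ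
  have hdτ : (r.den : ℝ) ≤ τ := le_trans (by exact_mod_cast hrn) (Nat.floor_le hτ0.le)
  have hcast : (r : ℝ) = (r.num : ℝ) / r.den := by exact_mod_cast (Rat.num_div_den r).symm
  refine ⟨r.num, r.den, Int.isCoprime_iff_nat_coprime.2 r.reduced, ?_, ?_, hdτ⟩
  · rw [← hcast]
    refine hr.trans (one_div_le_one_div_of_le (by positivity) ?_)
    rw [sq]
    gcongr
    linarith
  · by_contra! hlt
    apply hM
    have hr2 : |α - ((r / 2 : ℚ) : ℝ)| ≤ 1 / (2 * τ) := by
      have h1 : |2 * α - r| ≤ 1 / τ := by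
        refine hr.trans (one_div_le_one_div_of_le hτ0 ?_)
        nlinarith
      have h2 : α - ((r / 2 : ℚ) : ℝ) = (2 * α - r) / 2 := by push_cast; ring
      rw [h2, abs_div, abs_two, mul_comm 2 τ, ← div_div]
      gcongr
    set s : ℚ := r / 2 with hs
    have hsden : s.den ≤ 2 * r.den := by
      have : s.den ∣ r.den * 2 := by
        have := Rat.mul_den_dvd r (2⁻¹)
        rw [← div_eq_mul_inv] at this
        simpa using this
      have := Nat.le_of_dvd (by have := r.den_pos; omega) this
      omega
    have hs0 : (0 : ℝ) < s.den := by exact_mod_cast s.den_pos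
    have hsQ : (s.den : ℝ) ≤ Q := by
      have : (s.den : ℝ) ≤ 2 * r.den := by exact_mod_cast hsden
      linarith
    have hscast : (s : ℝ) = (s.num : ℝ) / s.den := by exact_mod_cast (Rat.num_div_den s).symm
    have hττ : 1 / (2 * τ) = 1 / τ / 2 := by rw [mul_comm, ← div_div]
    have hτi : 0 < 1 / τ := by positivity
    obtain ⟨hl, hu⟩ := abs_le.1 hr2
    have hnum0 : 0 ≤ s.num := by
      have h1 : -(2 / τ) < (s : ℝ) := by
        rw [show 2 / τ = 2 * (1 / τ) by ring]; linarith
      rw [hscast, lt_div_iff₀ hs0] at h1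
      have h2 : 2 / τ * s.den ≤ 1 := by
        rw [div_mul_eq_mul_div, div_le_iff₀ hτ0]; linarith
      have h3 : (-1 : ℝ) < s.num := by linarith
      have : (-1 : ℤ) < s.num := by exact_mod_cast h3
      omega
    have hnumlt : s.num < s.den := by
      have h1 : (s : ℝ) < 1 := by linarith
      rw [hscast, div_lt_one hs0] at h1
      exact_mod_cast h1
    refine ⟨⟨hα1, hα2⟩, s.den, s.num.natAbs, s.den_pos, hsQ, by omega, s.reduced, ?_⟩
    have : ((s.num.natAbs : ℕ) : ℝ) = (s.num : ℝ) := by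
      rw [Nat.cast_natAbs, abs_of_nonneg hnum0]
    rw [this, ← hscast]
    linarith

/-! ### Mean square of `F` -/

lemma integral_e_intCast_mul (k : ℤ) (c : ℝ) :
    ∫ α in c..c + 1, e (k * α) = if k = 0 then 1 else 0 := by
  split_ifs with hk
  · subst hk
    have : e 0 = 1 := by simpa using e_intCast 0
    simp [this]
  · have hk' : (2 * Real.pi * Complex.I * k : ℂ) ≠ 0 :=
      mul_ne_zero Complex.two_pi_I_ne_zero (by exact_mod_cast hk)
    have h : ∀ α : ℝ, e (k * α) = Complex.exp (2 * Real.pi * Complex.I * k * α) := fun α => by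
      rw [e]; push_cast; ring_nf
    simp_rw [h]
    rw [integral_exp_mul_complex hk', ← h, ← h,
      show (k : ℝ) * (c + 1) = k * c + (k : ℝ) by ring, e_add, e_intCast, mul_one, sub_self,
      zero_div]

lemma integral_norm_sum_mul_e_sq (s : Finset ℕ) (w : ℕ → ℝ) (c : ℝ) :
    ∫ α in c..c + 1, ‖∑ n ∈ s, (w n : ℂ) * e (α * n)‖ ^ 2 = ∑ n ∈ s, w n ^ 2 := by
  have hexp : ∀ α : ℝ, ((‖∑ n ∈ s, (w n : ℂ) * e (α * n)‖ ^ 2 : ℝ) : ℂ) =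
      ∑ n ∈ s, ∑ m ∈ s, (w n : ℂ) * w m * e ((((n : ℤ) - (m : ℤ) : ℤ) : ℝ) * α) := fun α => by
    rw [Complex.ofReal_pow, ← Complex.mul_conj', map_sum, sum_mul_sum]
    refine sum_congr rfl fun n _ => sum_congr rfl fun m _ => ?_
    rw [map_mul, Complex.conj_ofReal, conj_e, Int.cast_sub, Int.cast_natCast, Int.cast_natCast,
      show ((n : ℝ) - m) * α = α * n + -(α * m) by ring, e_add]
    ring
  have hcont : ∀ (z : ℂ) (k : ℤ), Continuous fun α : ℝ => z * e (k * α) := fun z k =>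
    continuous_const.mul (continuous_e.comp (by fun_prop))
  have h : ((∫ α in c..c + 1, ‖∑ n ∈ s, (w n : ℂ) * e (α * n)‖ ^ 2 : ℝ) : ℂ) =
      ((∑ n ∈ s, w n ^ 2 : ℝ) : ℂ) := by
    rw [← intervalIntegral.integral_ofReal]
    simp_rw [hexp]
    rw [intervalIntegral.integral_finsetSum fun n _ =>
      (continuous_finsetSum s fun m _ => hcont _ _).intervalIntegrable _ _]
    rw [Complex.ofReal_sum]
    refine sum_congr rfl fun n hn => ?_
    rw [intervalIntegral.integral_finsetSum fun m _ => (hcont _ _).intervalIntegrable _ _]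
    simp_rw [intervalIntegral.integral_const_mul, integral_e_intCast_mul, sub_eq_zero,
      Nat.cast_inj, mul_ite, mul_one, mul_zero]
    rw [sum_ite_eq, if_pos hn, Complex.ofReal_pow, sq]
  exact_mod_cast h

lemma continuous_F (N : ℕ) (A : ℝ) : Continuous (F N A) := by
  unfold F
  exact continuous_finsetSum _ fun p _ => continuous_const.mul (continuous_e.comp (by fun_prop))

lemma setIntegral_norm_F_sq_le {N : ℕ} {A L : ℝ} (hA1 : 1 ≤ A) (hAN : A ≤ N)
    (hL : 1 ≤ L) (hNL : Real.log N ≤ L) (c : ℝ) :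
    ∫ α in Set.Icc c (c + 1), ‖F N A α‖ ^ 2 ≤ 12 * A * L ^ 2 := by
  rw [integral_Icc_eq_integral_Ioc, ← intervalIntegral.integral_of_le (by linarith)]
  simp only [F]
  rw [integral_norm_sum_mul_e_sq]
  set s := (range (2 * N + 2)).filter
    (fun p => Nat.Prime p ∧ (N : ℝ) / 2 - A < (p : ℝ) ∧ (p : ℝ) ≤ (N : ℝ) / 2 + A) with hs
  have hN0 : (0 : ℝ) < N := by linarith
  have hcard : (#s : ℝ) ≤ 3 * A := by
    have hsub : s ⊆ Ioc ⌊(N : ℝ) / 2 - A⌋₊ ⌊(N : ℝ) / 2 + A⌋₊ := fun p hp => by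
      obtain ⟨_, hp, h1, h2⟩ := mem_filter.1 hp
      exact mem_Ioc.2 ⟨(Nat.floor_lt' hp.ne_zero).2 h1, Nat.le_floor h2⟩
    have h1 : (#s : ℝ) ≤ ((⌊(N : ℝ) / 2 + A⌋₊ - ⌊(N : ℝ) / 2 - A⌋₊ : ℕ) : ℝ) := by
      exact_mod_cast (card_le_card hsub).trans_eq (Nat.card_Ioc _ _)
    rw [Nat.cast_sub (Nat.floor_le_floor (by linarith))] at h1
    have h2 := Nat.floor_le (show 0 ≤ (N : ℝ) / 2 + A by linarith)
    have h3 := Nat.lt_floor_add_one ((N : ℝ) / 2 - A)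
    linarith
  calc ∑ p ∈ s, Real.log p ^ 2 ≤ ∑ p ∈ s, (2 * L) ^ 2 := by
        refine sum_le_sum fun p hp => ?_
        obtain ⟨_, hp, _, h2⟩ := mem_filter.1 hp
        refine pow_le_pow_left₀ (Real.log_natCast_nonneg p) ?_ 2
        have hp0 : (0 : ℝ) < p := by exact_mod_cast hp.pos
        have h3 : Real.log p ≤ Real.log (2 * N) := Real.log_le_log hp0 (by linarith)
        rw [Real.log_mul two_ne_zero hN0.ne'] at h3
        linarith [Real.log_two_lt_d9]
    _ = #s * (2 * L) ^ 2 := by rw [sum_const, nsmul_eq_mul]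
    _ ≤ 3 * A * (2 * L) ^ 2 := by gcongr
    _ = _ := by ring

lemma measurableSet_Minor (ε lam : ℝ) (N : ℕ) : MeasurableSet (Minor ε lam N) := by
  have h : Major ε lam N = Set.Icc (-(1 / tauof ε lam N)) (1 - 1 / tauof ε lam N) ∩
      ⋃ (q : ℕ) (a : ℕ) (_ : 1 ≤ q ∧ (q : ℝ) ≤ Qof lam N ∧ a < q ∧ Nat.gcd a q = 1),
        {α : ℝ | |α - (a : ℝ) / q| ≤ 1 / tauof ε lam N} := by
    ext α
    simp only [Major, Set.mem_ofPred_eq, Set.mem_inter_iff, Set.mem_iUnion, exists_prop, and_assoc]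
  rw [Minor, h]
  refine measurableSet_Icc.diff (measurableSet_Icc.inter ?_)
  exact MeasurableSet.iUnion fun q => MeasurableSet.iUnion fun a => MeasurableSet.iUnion fun _ =>
    measurableSet_le (by fun_prop) measurable_const

lemma norm_setIntegral_Minor_le {ε lam : ℝ} {N : ℕ} {A S : ℝ} (hS : 0 ≤ S)
    (h : ∀ α ∈ Minor ε lam N, ‖Ftilde A α‖ ≤ S) :
    ‖∫ α in Minor ε lam N, F N A α ^ 2 * Ftilde A α * e (-(N : ℝ) * α)‖ ≤
      S * ∫ α in Set.Icc (-(1 / tauof ε lam N)) (-(1 / tauof ε lam N) + 1), ‖F N A α‖ ^ 2 := by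
  have hsub : Minor ε lam N ⊆ Set.Icc (-(1 / tauof ε lam N)) (-(1 / tauof ε lam N) + 1) := by
    rw [neg_add_eq_sub]
    exact Set.sdiff_subset
  have hcont : Continuous fun α => S * ‖F N A α‖ ^ 2 :=
    continuous_const.mul ((continuous_F N A).norm.pow 2)
  have hint : IntegrableOn (fun α => S * ‖F N A α‖ ^ 2)
      (Set.Icc (-(1 / tauof ε lam N)) (-(1 / tauof ε lam N) + 1)) :=
    hcont.continuousOn.integrableOn_compact isCompact_Icc
  rw [← integral_const_mul]
  refine (norm_integral_le_of_norm_le (hint.mono_set hsub) ?_).trans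
    (setIntegral_mono_set hint (Filter.Eventually.of_forall fun α => by
      simp only [Pi.zero_apply]; positivity) hsub.eventuallyLE)
  refine ae_restrict_of_forall_mem (measurableSet_Minor ε lam N) fun α hα => ?_
  rw [norm_mul, norm_mul, norm_e, mul_one, norm_pow, mul_comm]
  gcongr
  exact h α hα

/-! ### Comparison of growth rates -/

lemma eventually_mul_exp_neg_mul_sqrt_le {ε : ℝ} (hε : 0 < ε) :
    ∀ᶠ x : ℝ in Filter.atTop, x * Real.exp (-ε * √x) ≤ 1 := by
  have h := ((isLittleO_pow_exp_pos_mul_atTop (k := 2) hε).bound one_pos)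
  filter_upwards [Real.tendsto_sqrt_atTop.eventually h, Filter.eventually_ge_atTop 0] with x hx hx0
  rw [Real.sq_sqrt hx0, one_mul, Real.norm_of_nonneg hx0,
    Real.norm_of_nonneg (Real.exp_pos _).le] at hx
  rw [neg_mul, Real.exp_neg, ← div_eq_mul_inv, div_le_one (Real.exp_pos _)]
  exact hx

lemma eventually_rpow_le_exp_sub_sqrt (lam : ℝ) {ε : ℝ} (hε : ε < 1) :
    ∀ᶠ x : ℝ in Filter.atTop,
      9 * x ^ 2 * (x ^ lam) ^ 3 ≤ Real.exp (x + -ε * √x + -ε * √x) := by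
  have h := (isLittleO_rpow_exp_pos_mul_atTop (2 + lam * 3)
    (show (0 : ℝ) < 1 / 2 by norm_num)).bound (show (0 : ℝ) < 1 / 9 by norm_num)
  filter_upwards [h, Filter.eventually_ge_atTop 16] with x hx hx16
  have hx0 : 0 < x := by linarith
  rw [Real.norm_of_nonneg (Real.rpow_nonneg hx0.le _),
    Real.norm_of_nonneg (Real.exp_pos _).le] at hx
  have hpow : x ^ 2 * (x ^ lam) ^ 3 = x ^ (2 + lam * 3) := by
    rw [Real.rpow_add hx0, Real.rpow_mul hx0.le]
    norm_cast
  have hs : 4 * √x ≤ x := by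
    have h4 : 4 ≤ √x := Real.le_sqrt_of_sq_le (by linarith)
    calc 4 * √x ≤ √x * √x := by gcongr
      _ = x := Real.mul_self_sqrt hx0.le
  have hεs : ε * √x ≤ √x := mul_le_of_le_one_left (Real.sqrt_nonneg x) hε.le
  calc _ = 9 * x ^ (2 + lam * 3) := by rw [← hpow]; ring
    _ ≤ Real.exp (1 / 2 * x) := by linarith
    _ ≤ _ := Real.exp_le_exp.2 (by linarith)

lemma eventually_growth {lam ε : ℝ} (hlam : 0 < lam) (hε : ε ∈ Set.Ioo (0 : ℝ) 1) :
    ∀ᶠ x : ℝ in Filter.atTop, 1 ≤ x ∧ 2 ≤ x ^ lam ∧ 1 ≤ ε * √x ∧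
      x * Real.exp (-ε * √x) ≤ 1 ∧
      9 * x ^ 2 * (x ^ lam) ^ 3 ≤ Real.exp (x + -ε * √x + -ε * √x) := by
  filter_upwards [Filter.eventually_ge_atTop 1,
    (tendsto_rpow_atTop hlam).eventually_ge_atTop 2,
    (Real.tendsto_sqrt_atTop.const_mul_atTop hε.1).eventually_ge_atTop 1,
    eventually_mul_exp_neg_mul_sqrt_le hε.1, eventually_rpow_le_exp_sub_sqrt lam hε.2]
    with x h1 h2 h3 h4 h5
  exact ⟨h1, h2, h3, h4, h5⟩

theorem stmt12 (lam ε : ℝ) (hlam : 10 < lam) (hε : ε ∈ Set.Ioo (0 : ℝ) 1) :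
    ∃ C > (0 : ℝ), ∃ N₀ : ℕ, ∀ N : ℕ, N₀ ≤ N → Even N →
      ‖∫ α in Minor ε lam N,
          F N (Aof ε N) α ^ 2 * Ftilde (Aof ε N) α * e (-(N : ℝ) * α)‖ ≤
        C * Aof ε N ^ 2 / Real.log N ^ (lam / 2 - 5) := by
  have hev := (Real.tendsto_log_atTop.comp tendsto_natCast_atTop_atTop).eventually
    (eventually_growth (by linarith) hε)
  obtain ⟨N₀, hN₀⟩ := Filter.eventually_atTop.1 hev
  refine ⟨9600, by norm_num, N₀, fun N hN _ => ?_⟩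
  obtain ⟨hx1, hQ, hεx, hxe, hgrow⟩ := hN₀ N hN
  simp only [Function.comp_apply] at hx1 hQ hεx hxe hgrow
  set x := Real.log N with hx
  have hN0 : (0 : ℝ) < N := by
    refine Nat.cast_pos.2 (Nat.pos_of_ne_zero fun h => ?_)
    rw [hx, h, Nat.cast_zero, Real.log_zero] at hx1
    linarith
  have hexp : Real.exp x = N := Real.exp_log hN0
  set A := Aof ε N with hA
  set d := Real.exp (-ε * √x) with hd
  have hd0 : 0 < d := Real.exp_pos _
  have hd1 : d ≤ 1 := Real.exp_le_one_iff.2 (by linarith)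
  have hAd : A = N * d := rfl
  have hA0 : 0 < A := mul_pos hN0 hd0
  have hQx : Qof lam N = x ^ lam := rfl
  set Q := x ^ lam with hQdef
  have hQ0 : 0 < Q := by linarith
  rw [Real.exp_add, Real.exp_add, hexp, ← hAd] at hgrow
  have hτ : tauof ε lam N = A * d / Q := by
    rw [tauof, hQx, ← hA, hAd]
    field_simp
  have hgrowA : 9 * x ^ 2 * Q ^ 3 ≤ A :=
    hgrow.trans (mul_le_of_le_one_right hA0.le hd1)
  have hQ9 : 2 * Q ^ 2 ≤ 9 * x ^ 2 * Q ^ 3 := by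
    have hx2 : 1 ≤ x ^ 2 := one_le_pow₀ hx1
    calc 2 * Q ^ 2 ≤ Q * Q ^ 2 := by gcongr
      _ = 1 * Q ^ 3 := by ring
      _ ≤ 9 * x ^ 2 * Q ^ 3 := by gcongr; linarith
  have hτQ : 2 * Qof lam N ≤ tauof ε lam N := by
    rw [hτ, hQx, le_div_iff₀ hQ0]
    linarith
  have hlogA : 1 + Real.log A ≤ x := by
    rw [hAd, Real.log_mul hN0.ne' hd0.ne', hd, Real.log_exp]
    linarith
  have hA1 : 1 ≤ A := by
    have : 1 ≤ Q ^ 2 := one_le_pow₀ (by linarith)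
    linarith
  have hbound : ∀ α ∈ Minor ε lam N, ‖Ftilde A α‖ ≤ 800 * x ^ 3 * (A / √Q) := by
    intro α hα
    obtain ⟨a, q, hc, happ, hq1, hq2⟩ := exists_approx_of_mem_Minor (hQx ▸ hQ) hτQ hα
    refine norm_Ftilde_le hc happ hQ hx1 hlogA hgrowA (hQx ▸ hq1) ?_
    calc (q : ℝ) * x ≤ A * d / Q * x := by rw [← hτ]; gcongr
      _ = A / Q * (x * d) := by ring
      _ ≤ A / Q := mul_le_of_le_one_right (by positivity) hxe
  have hpow : x ^ (lam / 2 - 5) = √Q / x ^ 5 := by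
    have hx0 : 0 < x := by linarith
    rw [Real.rpow_sub hx0, Real.sqrt_eq_rpow, hQdef, ← Real.rpow_mul hx0.le, mul_one_div]
    norm_cast
  have hR0 : 0 < √Q := Real.sqrt_pos.2 hQ0
  refine (norm_setIntegral_Minor_le (by positivity) hbound).trans ?_
  calc _ ≤ 800 * x ^ 3 * (A / √Q) * (12 * A * x ^ 2) := by
        gcongr
        exact setIntegral_norm_F_sq_le hA1 (by rw [hAd]; exact mul_le_of_le_one_right hN0.le hd1)
          hx1 le_rfl _
    _ = _ := by
        rw [hpow]
        field_simp
        norm_num
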